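/- Let τ ∈ ℍ, m₀, m₁, m₂, m₃ ∈ ℤ_{≥0} with Σ m_k ≥ 1, and let u be a solution of the curvature equation Δu + e^u = 8π Σ_{k=0}^{3} m_k δ_{ω_k/2} on E_τ. Suppose the associated potential q(z) = −(1/2)(u_zz − (1/2)u_z²) (where ∂_z = (1/2)(∂_x − i∂_y)) equals Σ_{k=0}^{3} m_k(m_k+1)·℘(z − ω_k/2|τ) − E for some E ∈ ℂ, i.e. all residues of q at the points ω_j/2 vanish, so the associated ODE is the Heun equation H(𝐦, E, τ). Then u is contained in an even family of solutions: the one-parameter family of solutions generated by a type II developing map of u contains a solution ũ with ũ(z) = ũ(−z) for all z. -/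

import Mathlib

open Metric Set Filter Topology

noncomputable section

/-- The lattice `Λ_τ = ℤ + τℤ` as a set of complex numbers. -/
def lat (τ : ℂ) : Set ℂ := {z | ∃ m n : ℤ, z = (m : ℂ) + (n : ℂ) * τ}

/-- The lattice point `m + nτ` attached to a pair of integers. -/
def latPt (τ : ℂ) (p : ℤ × ℤ) : ℂ := (p.1 : ℂ) + (p.2 : ℂ) * τ

/-- The Weierstrass elliptic function `℘(z|τ)`. -/
def wp (τ z : ℂ) : ℂ :=
  1 / z ^ 2 + ∑' p : {p : ℤ × ℤ // p ≠ 0},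
    (1 / (z - latPt τ p.1) ^ 2 - 1 / latPt τ p.1 ^ 2)

/-- `℘′(z|τ)`. -/
def wpd (τ z : ℂ) : ℂ := deriv (wp τ) z

/-- `℘″(z|τ)`. -/
def wpdd (τ z : ℂ) : ℂ := deriv (deriv (wp τ)) z

/-- The Weierstrass zeta function `ζ(z|τ)` (odd primitive of `-℘`). -/
def wzeta (τ z : ℂ) : ℂ :=
  1 / z + ∑' p : {p : ℤ × ℤ // p ≠ 0},
    (1 / (z - latPt τ p.1) + 1 / latPt τ p.1 + z / latPt τ p.1 ^ 2)

/-- The Weierstrass sigma function `σ(z|τ)`. -/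
def wsigma (τ z : ℂ) : ℂ :=
  z * ∏' p : {p : ℤ × ℤ // p ≠ 0},
    ((1 - z / latPt τ p.1) * Complex.exp (z / latPt τ p.1 + z ^ 2 / (2 * latPt τ p.1 ^ 2)))

/-- The periods `ω₀ = 0, ω₁ = 1, ω₂ = τ, ω₃ = 1 + τ`. -/
def per (τ : ℂ) : ℕ → ℂ
  | 0 => 0
  | 1 => 1
  | 2 => τ
  | 3 => 1 + τ
  | _ => 0

/-- `e_k(τ) = ℘(ω_k/2|τ)`. -/
def eper (τ : ℂ) (k : ℕ) : ℂ := wp τ (per τ k / 2)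

/-- The quasi-period `η₁(τ) = 2ζ(1/2|τ)`. -/
def eta1 (τ : ℂ) : ℂ := 2 * wzeta τ (1 / 2)

/-- The quasi-period `η₂(τ) = 2ζ(τ/2|τ)`. -/
def eta2 (τ : ℂ) : ℂ := 2 * wzeta τ (τ / 2)

/-- `η_k(τ)`, with `η₃ = η₁ + η₂`. -/
def etaq (τ : ℂ) : ℕ → ℂ
  | 1 => eta1 τ
  | 2 => eta2 τ
  | 3 => eta1 τ + eta2 τ
  | _ => 0

/-- The Hecke form `Z(r,s,τ) = ζ(r+sτ|τ) - r η₁(τ) - s η₂(τ)`. -/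
def heckeZ (r s τ : ℂ) : ℂ := wzeta τ (r + s * τ) - r * eta1 τ - s * eta2 τ

/-- The pre-modular form `Z^{(𝐦_k)}(r,s,τ) = Z(r,s,τ)² - ℘(r+sτ|τ) + e_k(τ)`. -/
def heckeZm (k : ℕ) (r s τ : ℂ) : ℂ := heckeZ r s τ ^ 2 - wp τ (r + s * τ) + eper τ k

/-- First component of `(r_k, s_k)`. -/
def rkr (k : ℕ) (r : ℂ) : ℂ := if k = 2 then r else r + 1 / 2

/-- Second component of `(r_k, s_k)`. -/
def rks (k : ℕ) (s : ℂ) : ℂ := if k = 1 then s else s + 1 / 2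

/-- `(r,s)` is a half-integer pair, i.e. belongs to `(1/2)ℤ²`. -/
def IsHalfIntPair (r s : ℂ) : Prop := ∃ m n : ℤ, r = (m : ℂ) / 2 ∧ s = (n : ℂ) / 2

/-- The singular set of the curvature equation: lattice translates of the points `ω_k/2`
with `m_k ≥ 1`. -/
def singSet (τ : ℂ) (m : Fin 4 → ℕ) : Set ℂ :=
  {z | ∃ k : Fin 4, 1 ≤ m k ∧ ∃ l ∈ lat τ, z = per τ (k : ℕ) / 2 + l}

/-- The Laplacian of a real-valued function on `ℂ ≃ ℝ²`. -/
def lapl (u : ℂ → ℝ) (z : ℂ) : ℝ :=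
  fderiv ℝ (fun w => fderiv ℝ u w (1 : ℂ)) z (1 : ℂ) +
  fderiv ℝ (fun w => fderiv ℝ u w Complex.I) z Complex.I

/-- `u` is a solution of the curvature equation `Δu + e^u = 8π Σ m_k δ_{ω_k/2}` on `E_τ`. -/
def IsCurvatureSolution (τ : ℂ) (m : Fin 4 → ℕ) (u : ℂ → ℝ) : Prop :=
  (∀ z, u (z + 1) = u z) ∧ (∀ z, u (z + τ) = u z) ∧
  (∀ z ∉ singSet τ m, (∀ n : ℕ, ContDiffAt ℝ n u z) ∧ lapl u z + Real.exp (u z) = 0) ∧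
  (∀ k : Fin 4, 1 ≤ m k → ∀ l ∈ lat τ,
    ∃ C ε : ℝ, 0 < ε ∧ ∀ z : ℂ, z ≠ per τ (k : ℕ) / 2 + l →
      dist z (per τ (k : ℕ) / 2 + l) < ε →
      |u z - 4 * (m k : ℝ) * Real.log (dist z (per τ (k : ℕ) / 2 + l))| ≤ C)

/-- Multiplicities for equation `(★_k)`: `m₀ = m_k = 1`, the others `0`. -/
def starM (k : ℕ) : Fin 4 → ℕ := fun j => if (j : ℕ) = 0 ∨ (j : ℕ) = k then 1 else 0

/-- `f` is a developing map of `u`: `f` is meromorphic on `ℂ` and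
`u = log (8|f′|²/(1+|f|²)²)` wherever `f` is analytic with nonvanishing derivative. -/
def IsDevelopingMapOf (u : ℂ → ℝ) (f : ℂ → ℂ) : Prop :=
  (∀ z : ℂ, MeromorphicAt f z) ∧
  ∀ z : ℂ, AnalyticAt ℂ f z → deriv f z ≠ 0 →
    u z = Real.log (8 * ‖deriv f z‖ ^ 2 / (1 + ‖f z‖ ^ 2) ^ 2)

/-- `f` satisfies the type II constraint for the torus `E_τ`. -/
def IsTypeII (τ : ℂ) (f : ℂ → ℂ) : Prop :=
  ∃ θ₁ θ₂ : ℝ,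
    (∀ z, f (z + 1) = Complex.exp (2 * Complex.I * (θ₁ : ℂ)) * f z) ∧
    (∀ z, f (z + τ) = Complex.exp (2 * Complex.I * (θ₂ : ℂ)) * f z)

/-- The one-parameter family of solutions generated by the developing map `f`
(with members `u_β` having developing map `e^β f`) contains an even solution. -/
def FamilyHasEven (τ : ℂ) (m : Fin 4 → ℕ) (f : ℂ → ℂ) : Prop :=
  ∃ (β : ℝ) (v : ℂ → ℝ), IsCurvatureSolution τ m v ∧
    IsDevelopingMapOf v (fun z => (Real.exp β : ℂ) * f z) ∧ ∀ z, v (-z) = v z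

/-- `u`, with type II developing map `f`, generates a non-even family of solutions. -/
def GeneratesNonEvenFamily (τ : ℂ) (m : Fin 4 → ℕ) (u : ℂ → ℝ) (f : ℂ → ℂ) : Prop :=
  IsCurvatureSolution τ m u ∧ IsDevelopingMapOf u f ∧ IsTypeII τ f ∧ ¬ FamilyHasEven τ m f

/-- The curvature equation has a non-even family of solutions. -/
def HasNonEvenFamily (τ : ℂ) (m : Fin 4 → ℕ) : Prop :=
  ∃ u f, GeneratesNonEvenFamily τ m u f

/-- The curvature equation has an even family of solutions. -/
def HasEvenFamily (τ : ℂ) (m : Fin 4 → ℕ) : Prop :=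
  ∃ (u : ℂ → ℝ) (f : ℂ → ℂ), IsCurvatureSolution τ m u ∧ IsDevelopingMapOf u f ∧
    IsTypeII τ f ∧ FamilyHasEven τ m f

/-- `y` is a (meromorphic, global) solution of `y″ = q·y` away from the singular set `S`. -/
def SolvesODEOn (q : ℂ → ℂ) (S : Set ℂ) (y : ℂ → ℂ) : Prop :=
  (∀ z : ℂ, MeromorphicAt y z) ∧
  ∀ z ∉ S, AnalyticAt ℂ y z ∧ deriv (deriv y) z = q z * y z

/-- Linear independence of two functions, tested away from the singular set `S`. -/
def LinIndepOn (S : Set ℂ) (y₁ y₂ : ℂ → ℂ) : Prop :=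
  ∀ a b : ℂ, (∀ z ∉ S, a * y₁ z + b * y₂ z = 0) → a = 0 ∧ b = 0

/-- The equation `y″ = q·y` (with singular set `S`) on `E_τ` has unitary monodromy: there is a
fundamental system of solutions whose monodromy matrices w.r.t. `z ↦ z+1` and `z ↦ z+τ`
lie in `SU(2)`. -/
def HasUnitaryMonodromy (q : ℂ → ℂ) (S : Set ℂ) (τ : ℂ) : Prop :=
  ∃ y₁ y₂ : ℂ → ℂ, SolvesODEOn q S y₁ ∧ SolvesODEOn q S y₂ ∧ LinIndepOn S y₁ y₂ ∧
    ∃ M₁ M₂ : Matrix (Fin 2) (Fin 2) ℂ,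
      M₁ ∈ Matrix.unitaryGroup (Fin 2) ℂ ∧ M₁.det = 1 ∧
      M₂ ∈ Matrix.unitaryGroup (Fin 2) ℂ ∧ M₂.det = 1 ∧
      (∀ z, y₁ (z + 1) = M₁ 0 0 * y₁ z + M₁ 0 1 * y₂ z) ∧
      (∀ z, y₂ (z + 1) = M₁ 1 0 * y₁ z + M₁ 1 1 * y₂ z) ∧
      (∀ z, y₁ (z + τ) = M₂ 0 0 * y₁ z + M₂ 0 1 * y₂ z) ∧
      (∀ z, y₂ (z + τ) = M₂ 1 0 * y₁ z + M₂ 1 1 * y₂ z)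

/-- The potential of the Fuchsian equation `L(𝐦_k, T, E, τ)`. -/
def LPot (k : ℕ) (T E τ : ℂ) (z : ℂ) : ℂ :=
  2 * wp τ z + 2 * wp τ (z - per τ k / 2) +
    T * (wzeta τ (z - per τ k / 2) - wzeta τ z) - E

/-- The singular set of `L(𝐦_k, T, E, τ)`: lattice translates of `0` and `ω_k/2`. -/
def LSing (τ : ℂ) (k : ℕ) : Set ℂ := {z | ∃ l ∈ lat τ, z = l ∨ z = per τ k / 2 + l}

/-- The equation `y″ = q·y` is apparent (free of logarithmic singularity) at `p`: there are two
linearly independent single-valued solutions on a punctured neighborhood of `p`, both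
meromorphic at `p`. -/
def ApparentAt (q : ℂ → ℂ) (p : ℂ) : Prop :=
  ∃ (y₁ y₂ : ℂ → ℂ) (ε : ℝ), 0 < ε ∧
    (∀ z ∈ Metric.ball p ε, z ≠ p →
      AnalyticAt ℂ y₁ z ∧ AnalyticAt ℂ y₂ z ∧
      deriv (deriv y₁) z = q z * y₁ z ∧ deriv (deriv y₂) z = q z * y₂ z) ∧
    MeromorphicAt y₁ p ∧ MeromorphicAt y₂ p ∧
    ∀ a b : ℂ, (∀ z ∈ Metric.ball p ε, z ≠ p → a * y₁ z + b * y₂ z = 0) → a = 0 ∧ b = 0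

/-- The translated (even) potential `q_k(z;T,E)` of `L(𝐦_k, T, E, τ)`. -/
def qPot (k : ℕ) (T E τ : ℂ) (z : ℂ) : ℂ :=
  2 * (wp τ (z + per τ k / 4) + wp τ (z - per τ k / 4)) +
    T * (wzeta τ (z + per τ k / 4) - wzeta τ (z - per τ k / 4)) - E

/-- The singular set of the translated potential: lattice translates of `±ω_k/4`. -/
def qSing (τ : ℂ) (k : ℕ) : Set ℂ :=
  {z | ∃ l ∈ lat τ, z = per τ k / 4 + l ∨ z = -(per τ k / 4) + l}

/-- The even elliptic solution `Φ_e(z;T,E)` of the second symmetric product equation. -/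
def PhiE (τ : ℂ) (k : ℕ) (T E : ℂ) (z : ℂ) : ℂ :=
  (wpd τ (per τ k / 4)) ^ 4 / (wp τ z - wp τ (per τ k / 4)) ^ 2 +
  (wpd τ (per τ k / 4)) ^ 2 * (wpd τ (per τ k / 4) * T + wpdd τ (per τ k / 4)) /
      (wp τ z - wp τ (per τ k / 4)) +
  (1 / 4) * (4 * (wpd τ (per τ k / 4)) ^ 2 * E + 3 * (wpd τ (per τ k / 4)) ^ 2 * T ^ 2
    - 8 * wzeta τ (per τ k / 4) * (wpd τ (per τ k / 4)) ^ 2 * T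
    + 32 * wp τ (per τ k / 4) * (wpd τ (per τ k / 4)) ^ 2
    - 3 * (wpdd τ (per τ k / 4)) ^ 2)

/-- For `k ∈ {1,2,3}`, the other two indices, so that `{k, i, i′} = {1,2,3}`. -/
def otherTwo : ℕ → ℕ × ℕ
  | 1 => (2, 3)
  | 2 => (1, 3)
  | 3 => (1, 2)
  | _ => (0, 0)

/-- The Wirtinger derivative `∂_z g = (1/2)(∂_x g - i ∂_y g)`. -/
def wirt (g : ℂ → ℂ) (z : ℂ) : ℂ :=
  (1 / 2) * (fderiv ℝ g z (1 : ℂ) - Complex.I * fderiv ℝ g z Complex.I)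

/-- The potential `q(z) = -(1/2)(u_zz - (1/2) u_z²)` associated with a solution `u`. -/
def uPot (u : ℂ → ℝ) (z : ℂ) : ℂ :=
  -(1 / 2) * (wirt (wirt (fun w => ((u w : ℝ) : ℂ))) z -
    (1 / 2) * (wirt (fun w => ((u w : ℝ) : ℂ)) z) ^ 2)

/-- All lattice translates of the four half-periods. -/
def fullSing (τ : ℂ) : Set ℂ := {z | ∃ k : Fin 4, ∃ l ∈ lat τ, z = per τ (k : ℕ) / 2 + l}

/-- The potential of the general Fuchsian equation (with residues `T₁, T₂, T₃`). -/
def q8 (τ : ℂ) (m : Fin 4 → ℕ) (T₁ T₂ T₃ E : ℂ) (z : ℂ) : ℂ :=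
  (∑ k : Fin 4, (m k : ℂ) * ((m k : ℂ) + 1) * wp τ (z - per τ (k : ℕ) / 2)) +
  T₁ * (wzeta τ (z - per τ 1 / 2) - wzeta τ z) +
  T₂ * (wzeta τ (z - per τ 2 / 2) - wzeta τ z) +
  T₃ * (wzeta τ (z - per τ 3 / 2) - wzeta τ z) - E

/-- The elliptic-of-the-second-kind ansatz built from sigma functions. -/
def sigY (τ : ℂ) (k : ℕ) (a₁ a₂ c : ℂ) (z : ℂ) : ℂ :=
  Complex.exp (c * z) * wsigma τ (z - a₁) * wsigma τ (z - a₂) /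
    (wsigma τ (z - per τ k / 4) * wsigma τ (z + per τ k / 4))

end

open Metric Set Filter Topology

lemma convex_diff_countable_preconn {U s : Set ℂ} (hU : IsOpen U) (hc : Convex ℝ U)
    (hs : s.Countable) : IsPreconnected (U \ s) := by
  rcases (U \ s).eq_empty_or_nonempty with he | ⟨a, ha⟩
  · rw [he]; exact isPreconnected_empty
  suffices IsPathConnected (U \ s) from this.isConnected.isPreconnected
  refine ⟨a, ha, ?_⟩
  intro b hb
  rcases eq_or_ne a b with rfl | hab
  · exact JoinedIn.refl ha
  let c := (2 : ℝ)⁻¹ • (a + b)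
  let x := (2 : ℝ)⁻¹ • (b - a)
  have Ia : c - x = a := by
    simp only [c, x]
    module
  have Ib : c + x = b := by
    simp only [c, x]
    module
  have x_ne_zero : x ≠ 0 := by simpa [x] using sub_ne_zero.2 hab.symm
  have hcU : c ∈ U := by
    have := hc ha.1 hb.1 (a := (2:ℝ)⁻¹) (b := (2:ℝ)⁻¹) (by norm_num) (by norm_num) (by norm_num)
    simpa [c, smul_add] using this
  obtain ⟨y, hy⟩ : ∃ y, LinearIndependent ℝ ![x, y] :=
    exists_linearIndependent_pair_of_one_lt_rank (by simp) x_ne_zero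
  have A : Set.Countable {t : ℝ | (segment ℝ (c + x) (c + t • y) ∩ s).Nonempty} := by
    apply countable_ofPred_nonempty_of_disjoint _ (fun t ↦ inter_subset_right) hs
    intro t t' htt'
    apply disjoint_iff_inter_eq_empty.2
    have N : {c + x} ∩ s = ∅ := by
      simpa only [singleton_inter_eq_empty, mem_compl_iff, Ib] using hb.2
    rw [inter_assoc, inter_comm s, inter_assoc, inter_self, ← inter_assoc, ← subset_empty_iff, ← N]
    apply inter_subset_inter_left
    apply Eq.subset
    apply segment_inter_eq_endpoint_of_linearIndependent_of_ne hy htt'.symm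
  have B : Set.Countable {t : ℝ | (segment ℝ (c - x) (c + t • y) ∩ s).Nonempty} := by
    apply countable_ofPred_nonempty_of_disjoint _ (fun t ↦ inter_subset_right) hs
    intro t t' htt'
    apply disjoint_iff_inter_eq_empty.2
    have N : {c - x} ∩ s = ∅ := by
      simpa only [singleton_inter_eq_empty, mem_compl_iff, Ia] using ha.2
    rw [inter_assoc, inter_comm s, inter_assoc, inter_self, ← inter_assoc, ← subset_empty_iff, ← N]
    apply inter_subset_inter_left
    rw [sub_eq_add_neg _ x]
    apply Eq.subset
    apply segment_inter_eq_endpoint_of_linearIndependent_of_ne _ htt'.symm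
    convert! hy.units_smul ![-1, 1]
    simp [← List.ofFn_inj]
  have hO : IsOpen {t : ℝ | c + t • y ∈ U} := hU.preimage (by fun_prop)
  obtain ⟨t, htU, ht⟩ := ((A.union B).dense_compl ℝ).inter_open_nonempty _ hO ⟨0, by simpa using hcU⟩
  let z := c + t • y
  have hz : z ∈ U := htU
  simp only [compl_union, mem_inter_iff, mem_compl_iff, mem_ofPred_eq, not_nonempty_iff_eq_empty]
    at ht
  have JA : JoinedIn (U \ s) a z := by
    apply JoinedIn.of_segment_subset
    rw [subset_sdiff]
    refine ⟨hc.segment_subset ha.1 hz, ?_⟩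
    rw [disjoint_iff_inter_eq_empty]
    convert! ht.2
    exact Ia.symm
  have JB : JoinedIn (U \ s) b z := by
    apply JoinedIn.of_segment_subset
    rw [subset_sdiff]
    refine ⟨hc.segment_subset hb.1 hz, ?_⟩
    rw [disjoint_iff_inter_eq_empty]
    convert! ht.1
    exact Ib.symm
  exact JA.trans JB.symm

/-- Abstract continuation in the plane. -/
lemma plane_glue {V : Type*} (G : (ℂ → V) → ℂ → Prop)
    (h1 : ∀ Y Y' z, Y =ᶠ[𝓝 z] Y' → G Y z → G Y' z)
    (h2 : ∀ p, ∃ r > 0, ∀ Y U, IsOpen U → Convex ℝ U → (U ∩ ball p r).Nonempty →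
      (∀ z ∈ U ∩ ball p r, G Y z) →
      ∃ Y', (∀ z ∈ ball p r, G Y' z) ∧ EqOn Y Y' (U ∩ ball p r))
    (h3 : ∀ Y Y' U z, IsOpen U → Convex ℝ U → z ∈ U → (∀ w ∈ U, G Y w) → (∀ w ∈ U, G Y' w) →
      Y =ᶠ[𝓝 z] Y' → EqOn Y Y' U)
    (Y₀ : ℂ → V) (r₀ : ℝ) (hr₀ : 0 < r₀) (hY₀ : ∀ z ∈ ball (0:ℂ) r₀, G Y₀ z) :
    ∃ Y, (∀ z, G Y z) ∧ Y =ᶠ[𝓝 0] Y₀ := by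
  classical
  let A : Set ℝ := {R | 0 < R ∧ ∃ Y, (∀ z ∈ ball (0:ℂ) R, G Y z) ∧ Y =ᶠ[𝓝 0] Y₀}
  have hA0 : r₀ ∈ A := ⟨hr₀, Y₀, hY₀, .rfl⟩
  -- union
  have key : ∃ Y, (∀ R ∈ A, ∀ z ∈ ball (0:ℂ) R, G Y z) ∧ Y =ᶠ[𝓝 0] Y₀ := by
    have hch : ∀ R : A, ∃ Y, (∀ z ∈ ball (0:ℂ) R.1, G Y z) ∧ Y =ᶠ[𝓝 0] Y₀ := fun R => R.2.2
    choose F hF1 hF2 using hch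
    have hcomp : ∀ R R' : A, ∀ z, z ∈ ball (0:ℂ) R → z ∈ ball (0:ℂ) R' → F R z = F R' z := by
      intro R R' z hz hz'
      refine h3 (F R) (F R') (ball 0 R.1 ∩ ball 0 R'.1) 0 (isOpen_ball.inter isOpen_ball)
        ((convex_ball _ _).inter (convex_ball _ _)) ?_ ?_ ?_ ?_ ⟨hz, hz'⟩
      · exact ⟨mem_ball_self R.2.1, mem_ball_self R'.2.1⟩
      · exact fun w hw => hF1 _ _ hw.1
      · exact fun w hw => hF1 _ _ hw.2
      · exact (hF2 R).trans (hF2 R').symm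
    let Y : ℂ → V := fun z => if h : ∃ R : A, z ∈ ball (0:ℂ) R.1 then F h.choose z else Y₀ z
    have hY : ∀ R : A, EqOn Y (F R) (ball (0:ℂ) R.1) := by
      intro R z hz
      have h : ∃ R : A, z ∈ ball (0:ℂ) R.1 := ⟨R, hz⟩
      simp only [Y, dif_pos h]
      exact hcomp _ _ z h.choose_spec hz
    refine ⟨Y, ?_, ?_⟩
    · intro R hR z hz
      refine h1 (F ⟨R, hR⟩) Y z ?_ (hF1 ⟨R, hR⟩ z hz)
      exact ((hY ⟨R, hR⟩).eventuallyEq_of_mem (isOpen_ball.mem_nhds hz)).symm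
    · exact ((hY ⟨r₀, hA0⟩).eventuallyEq_of_mem (isOpen_ball.mem_nhds (mem_ball_self hr₀))).trans
        (hF2 ⟨r₀, hA0⟩)
  obtain ⟨Y, hYA, hY0⟩ := key
  by_cases hb : BddAbove A
  swap
  · refine ⟨Y, fun z => ?_, hY0⟩
    rw [not_bddAbove_iff] at hb
    obtain ⟨R, hR, hzR⟩ := hb ‖z‖
    exact hYA R hR z (by simpa using hzR)
  exfalso
  set R := sSup A with hRdef
  have hRpos : 0 < R := hr₀.trans_le (le_csSup hb hA0)
  have hYR : ∀ z ∈ ball (0:ℂ) R, G Y z := by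
    intro z hz
    obtain ⟨R', hR', hzR⟩ := exists_lt_of_lt_csSup ⟨_, hA0⟩ (show ‖z‖ < sSup A by simpa using hz)
    exact hYA R' hR' z (by simpa using hzR)
  choose r hr hext using h2
  have hmeet : ∀ p ∈ sphere (0:ℂ) R, (ball (0:ℂ) R ∩ ball p (r p)).Nonempty := by
    intro p hp
    have hpc : p ∈ closure (ball (0:ℂ) R) := by
      rw [closure_ball _ hRpos.ne']; exact sphere_subset_closedBall hp
    obtain ⟨w, hw1, hw2⟩ := mem_closure_iff.1 hpc (ball p (r p)) isOpen_ball (mem_ball_self (hr p))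
    exact ⟨w, hw2, hw1⟩
  have hE : ∀ p : sphere (0:ℂ) R, ∃ Y', (∀ z ∈ ball p.1 (r p), G Y' z) ∧
      EqOn Y Y' (ball (0:ℂ) R ∩ ball p.1 (r p)) := fun p =>
    hext p Y (ball 0 R) isOpen_ball (convex_ball _ _) (hmeet p p.2) (fun z hz => hYR z hz.1)
  choose F hF1 hF2 using hE
  have hcomp : ∀ p p' : sphere (0:ℂ) R, ∀ z, z ∈ ball p.1 (r p) → z ∈ ball p'.1 (r p') →
      F p z = F p' z := by
    intro p p' z hz hz'
    rcases eq_or_ne p p' with rfl | hne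
    · rfl
    have hne' : p.1 ≠ p'.1 := fun h => hne (Subtype.ext h)
    -- a point on the segment in both balls
    have hd : dist p.1 p'.1 < r p + r p' := by
      have := dist_triangle p.1 z p'.1
      rw [mem_ball] at hz hz'
      rw [dist_comm] at hz
      linarith
    obtain ⟨t, ht0, ht1, hta, htb⟩ : ∃ t : ℝ, 0 < t ∧ t < 1 ∧ t * dist p.1 p'.1 < r p ∧
        (1 - t) * dist p.1 p'.1 < r p' := by
      have hdp : 0 < dist p.1 p'.1 := dist_pos.2 hne'
      have a1 := hr p
      have a2 := hr p'
      refine ⟨r p / (r p + r p'), by positivity, ?_, ?_, ?_⟩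
      · rw [div_lt_one (by positivity)]; linarith
      · rw [div_mul_eq_mul_div, div_lt_iff₀ (by positivity)]
        exact mul_lt_mul_of_pos_left hd a1
      · have : 1 - r p / (r p + r p') = r p' / (r p + r p') := by field_simp; ring
        rw [this, div_mul_eq_mul_div, div_lt_iff₀ (by positivity)]
        exact mul_lt_mul_of_pos_left hd a2
    let s : ℂ := (1 - t) • p.1 + t • p'.1
    have hsp : s ∈ ball p.1 (r p) := by
      rw [mem_ball, dist_eq_norm]
      have : s - p.1 = t • (p'.1 - p.1) := by simp only [s]; module
      rw [this, norm_smul, Real.norm_of_nonneg ht0.le, ← dist_eq_norm, dist_comm]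
      exact hta
    have hsp' : s ∈ ball p'.1 (r p') := by
      rw [mem_ball, dist_eq_norm]
      have : s - p'.1 = (1 - t) • (p.1 - p'.1) := by simp only [s]; module
      rw [this, norm_smul, Real.norm_of_nonneg (by linarith), ← dist_eq_norm]
      exact htb
    have hsR : s ∈ ball (0:ℂ) R := by
      have := strictConvex_closedBall ℝ (0:ℂ) R (sphere_subset_closedBall p.2)
        (sphere_subset_closedBall p'.2) hne' (a := 1 - t) (b := t) (by linarith) ht0 (by ring)
      rwa [interior_closedBall _ hRpos.ne'] at this
    refine h3 (F p) (F p') (ball p.1 (r p) ∩ ball p'.1 (r p')) s (isOpen_ball.inter isOpen_ball)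
        ((convex_ball _ _).inter (convex_ball _ _)) ⟨hsp, hsp'⟩ ?_ ?_ ?_ ⟨hz, hz'⟩
    · exact fun w hw => hF1 _ _ hw.1
    · exact fun w hw => hF1 _ _ hw.2
    · filter_upwards [isOpen_ball.mem_nhds hsp, isOpen_ball.mem_nhds hsp',
        isOpen_ball.mem_nhds hsR] with w hw1 hw2 hw3
      rw [← hF2 p ⟨hw3, hw1⟩, ← hF2 p' ⟨hw3, hw2⟩]
  let Z : ℂ → V := fun z => if z ∈ ball (0:ℂ) R then Y z else
    if h : ∃ p : sphere (0:ℂ) R, z ∈ ball p.1 (r p) then F h.choose z else Y z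
  have hZ0 : EqOn Z Y (ball (0:ℂ) R) := fun z hz => by simp only [Z, if_pos hz]
  have hZp : ∀ p : sphere (0:ℂ) R, EqOn Z (F p) (ball p.1 (r p)) := by
    intro p z hz
    by_cases hzR : z ∈ ball (0:ℂ) R
    · rw [hZ0 hzR]; exact hF2 p ⟨hzR, hz⟩
    · have h : ∃ p : sphere (0:ℂ) R, z ∈ ball p.1 (r p) := ⟨p, hz⟩
      simp only [Z, if_neg hzR, dif_pos h]
      exact hcomp _ _ z h.choose_spec hz
  let W : Set ℂ := ball (0:ℂ) R ∪ ⋃ p : sphere (0:ℂ) R, ball p.1 (r p)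
  have hWo : IsOpen W := isOpen_ball.union (isOpen_iUnion fun _ => isOpen_ball)
  have hWc : closedBall (0:ℂ) R ⊆ W := by
    intro z hz
    rcases (mem_closedBall.1 hz).lt_or_eq with h | h
    · exact Or.inl h
    · exact Or.inr (mem_iUnion.2 ⟨⟨z, h⟩, mem_ball_self (hr _)⟩)
  obtain ⟨δ, hδ, hsub⟩ := (isCompact_closedBall (0:ℂ) R).exists_thickening_subset_open hWo hWc
  rw [thickening_closedBall hδ hRpos.le] at hsub
  have hmem : δ + R ∈ A := by
    refine ⟨by linarith, Z, ?_, ?_⟩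
    · intro z hz
      rcases hsub hz with h | h
      · exact h1 Y Z z (hZ0.eventuallyEq_of_mem (isOpen_ball.mem_nhds h)).symm (hYR z h)
      · obtain ⟨p, hp⟩ := mem_iUnion.1 h
        exact h1 (F p) Z z ((hZp p).eventuallyEq_of_mem (isOpen_ball.mem_nhds hp)).symm
          (hF1 p z hp)
    · exact (hZ0.eventuallyEq_of_mem (isOpen_ball.mem_nhds (mem_ball_self hRpos))).trans hY0
  have := le_csSup hb hmem
  linarith

open Metric Set Filter Topology

lemma powser_summable {a : ℕ → ℂ} {K M : ℝ} (hM : 0 < M) (ha : ∀ n, ‖a n‖ ≤ K * M ^ n) {z : ℂ}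
    (hz : M * ‖z‖ < 1) : Summable (fun n => ‖a n * z ^ n‖) := by
  refine Summable.of_nonneg_of_le (fun _ => norm_nonneg _) (f := fun n => K * (M * ‖z‖) ^ n) ?_ ?_
  · intro n
    rw [norm_mul, norm_pow, mul_pow, ← mul_assoc]
    exact mul_le_mul_of_nonneg_right (ha n) (by positivity)
  · exact (summable_geometric_of_lt_one (by positivity) hz).mul_left K

lemma powser_deriv {a : ℕ → ℂ} {K M : ℝ} (hM : 0 < M) (ha : ∀ n, ‖a n‖ ≤ K * M ^ n) {z : ℂ}
    (hz : M * ‖z‖ < 1) :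
    HasDerivAt (fun z => ∑' n, a n * z ^ n) (∑' n : ℕ, ((n + 1 : ℂ) * a (n + 1)) * z ^ n) z := by
  have hK : 0 ≤ K := by simpa using (norm_nonneg _).trans (ha 0)
  obtain ⟨ρ, hρ1, hρ2⟩ := exists_between ((lt_div_iff₀' hM).2 hz)
  have hρ2' : M * ρ < 1 := (lt_div_iff₀' hM).1 hρ2
  have hρ0 : 0 ≤ ρ := (norm_nonneg z).trans hρ1.le
  have hsum : Summable (fun n : ℕ => K * M ^ n * ((n : ℝ) * ρ ^ (n - 1))) := by
    rw [← summable_nat_add_iff 1]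
    have h1 : Summable (fun n : ℕ => ((n : ℝ) ^ 1 * (M * ρ) ^ n)) :=
      summable_pow_mul_geometric_of_norm_lt_one 1 (by rw [Real.norm_of_nonneg (by positivity)]; exact hρ2')
    have h2 : Summable (fun n : ℕ => (M * ρ) ^ n) :=
      summable_geometric_of_lt_one (by positivity) hρ2'
    refine ((h1.add h2).mul_left (K * M)).congr ?_
    intro n
    push_cast
    simp only [Nat.add_sub_cancel, mul_pow, pow_succ]
    ring
  have hmain := hasDerivAt_tsum_of_isPreconnected (g := fun n z => a n * z ^ n)
    (g' := fun n z => a n * ((n : ℂ) * z ^ (n - 1))) (y₀ := z) (y := z) hsum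
    (isOpen_ball (x := (0:ℂ)) (ε := ρ)) isPreconnected_ball
    (fun n y _ => (hasDerivAt_pow n y).const_mul (a n)) ?_ (by simpa using hρ1)
    (powser_summable hM ha hz).of_norm (by simpa using hρ1)
  · refine hmain.congr_deriv ?_
    have hs : Summable (fun n : ℕ => a n * ((n : ℂ) * z ^ (n - 1))) := by
      refine Summable.of_norm (Summable.of_nonneg_of_le (fun _ => norm_nonneg _) ?_ hsum)
      intro n
      rw [norm_mul, norm_mul, norm_pow]
      simp only [Complex.norm_natCast]
      gcongr
      exact ha n
    rw [hs.tsum_eq_zero_add]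
    simp only [Nat.cast_zero, zero_mul, mul_zero, zero_add, Nat.add_sub_cancel]
    refine tsum_congr fun n => ?_
    push_cast; ring
  · intro n y hy
    rw [norm_mul, norm_mul, norm_pow]
    simp only [Complex.norm_natCast]
    have : ‖y‖ ≤ ρ := by simpa using (mem_ball.1 hy).le
    gcongr
    exact ha n

lemma powser_bound_shift {a : ℕ → ℂ} {K M : ℝ} (hM : 0 < M) (ha : ∀ n, ‖a n‖ ≤ K * M ^ n) (n : ℕ) :
    ‖(n + 1 : ℂ) * a (n + 1)‖ ≤ (K * M) * (2 * M) ^ n := by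
  have hK : 0 ≤ K := by simpa using (norm_nonneg _).trans (ha 0)
  rw [norm_mul]
  have h1 : ‖(n + 1 : ℂ)‖ ≤ 2 ^ n := by
    have : (n + 1 : ℂ) = ((n + 1 : ℕ) : ℂ) := by push_cast; ring
    rw [this, Complex.norm_natCast]
    exact_mod_cast Nat.lt_two_pow_self
  calc _ ≤ 2 ^ n * (K * M ^ (n + 1)) := by gcongr; exact ha _
    _ = _ := by rw [mul_pow, pow_succ]; ring

/-- Frobenius coefficients. -/
noncomputable def frobC (h : ℕ → ℂ) (s : ℤ) : ℕ → ℂ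
  | 0 => 1
  | n + 1 => (∑ i : Fin n, frobC h s i * h (n - 1 - i)) / ((n + 1 : ℂ) * (n + 2 * s : ℂ))
termination_by n => n
decreasing_by omega

lemma frobC_zero (h : ℕ → ℂ) (s : ℤ) : frobC h s 0 = 1 := by rw [frobC]

lemma frobC_succ (h : ℕ → ℂ) (s : ℤ) (n : ℕ) : frobC h s (n + 1) =
    (∑ i ∈ Finset.range n, frobC h s i * h (n - 1 - i)) / ((n + 1 : ℂ) * (n + 2 * s : ℂ)) := by
  rw [frobC, Finset.sum_range]

lemma frobC_bound (h : ℕ → ℂ) (s : ℤ) {A B : ℝ} (hA : 0 ≤ A) (hB : 0 ≤ B)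
    (hh : ∀ n, ‖h n‖ ≤ A * B ^ n) (n : ℕ) : ‖frobC h s n‖ ≤ (1 + A + B) ^ n := by
  induction n using Nat.strong_induction_on with
  | _ n ih =>
    rcases n with _ | n
    · simp [frobC_zero]
    set M := 1 + A + B
    have hM1 : 1 ≤ M := by simp only [M]; linarith
    rw [frobC_succ, norm_div]
    by_cases hz : (n + 2 * s : ℂ) = 0
    · rw [hz]; simp; positivity
    have hden : (n + 1 : ℝ) ≤ ‖((n + 1 : ℂ) * (n + 2 * s : ℂ))‖ := by
      rw [norm_mul]
      have e1 : ‖(n + 1 : ℂ)‖ = n + 1 := by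
        have : (n + 1 : ℂ) = ((n + 1 : ℕ) : ℂ) := by push_cast; ring
        rw [this, Complex.norm_natCast]; push_cast; ring
      have e2 : (1 : ℝ) ≤ ‖(n + 2 * s : ℂ)‖ := by
        have : (n + 2 * s : ℂ) = ((n + 2 * s : ℤ) : ℂ) := by push_cast; ring
        rw [this] at hz ⊢
        rw [Complex.norm_intCast]
        have : (n + 2 * s : ℤ) ≠ 0 := by exact_mod_cast hz
        exact_mod_cast Int.one_le_abs this
      rw [e1]; nlinarith
    rw [div_le_iff₀ (by linarith [n.cast_nonneg (α := ℝ)])]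
    rcases Nat.eq_zero_or_pos n with rfl | hn
    · simp; positivity
    calc ‖∑ i ∈ Finset.range n, frobC h s i * h (n - 1 - i)‖
        ≤ ∑ i ∈ Finset.range n, A * M ^ (n - 1) := by
          refine norm_sum_le_of_le _ fun i hi => ?_
          have hi' : i < n := Finset.mem_range.1 hi
          rw [norm_mul]
          calc _ ≤ M ^ i * (A * M ^ (n - 1 - i)) := by
                gcongr
                · exact ih i (by omega)
                · refine (hh _).trans ?_
                  gcongr
                  simp only [M]; linarith
            _ = A * M ^ (n - 1) := by
                have : M ^ (n - 1) = M ^ i * M ^ (n - 1 - i) := by rw [← pow_add]; congr 1; omega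
                rw [this]; ring
      _ = n * (A * M ^ (n - 1)) := by simp
      _ ≤ (n + 1) * M ^ (n + 1) := by
          have e : M ^ (n + 1) = M ^ (n - 1) * M ^ 2 := by rw [← pow_add]; congr 1; omega
          rw [e]
          have : A ≤ M ^ 2 := by simp only [M]; nlinarith
          have h3 : A * M ^ (n - 1) ≤ M ^ (n - 1) * M ^ 2 := by
            rw [mul_comm]; gcongr
          have h4 : 0 ≤ M ^ (n - 1) * M ^ 2 := by positivity
          nlinarith [n.cast_nonneg (α := ℝ)]
      _ ≤ _ := by rw [mul_comm]; gcongr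

lemma frobC_odd (h : ℕ → ℂ) (s : ℤ) (ho : ∀ n, Odd n → h n = 0) (n : ℕ) (hn : Odd n) :
    frobC h s n = 0 := by
  induction n using Nat.strong_induction_on with
  | _ n ih =>
    rcases n with _ | n
    · simp at hn
    rw [frobC_succ, Finset.sum_eq_zero, zero_div]
    intro i hi
    have hi' := Finset.mem_range.1 hi
    rcases Nat.even_or_odd i with he | hod
    · rw [ho, mul_zero]
      rcases he with ⟨c, hc⟩; rcases hn with ⟨d, hd⟩
      exact ⟨d - c - 1, by omega⟩
    · rw [ih i (by omega) hod, zero_mul]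

lemma frobC_rec (h : ℕ → ℂ) (s : ℤ) (hs : 0 ≤ s ∨ ∀ n, Odd n → h n = 0) (n : ℕ) :
    ((n + 1 : ℂ) * (n + 2 * s : ℂ)) * frobC h s (n + 1) =
      ∑ i ∈ Finset.range n, frobC h s i * h (n - 1 - i) := by
  by_cases hz : (n + 2 * s : ℂ) = 0
  · have hz' : (n + 2 * s : ℤ) = 0 := by
      have : ((n + 2 * s : ℤ) : ℂ) = 0 := by push_cast; exact hz
      exact_mod_cast this
    rw [hz, mul_zero, zero_mul, Finset.sum_eq_zero]
    intro i hi
    have hi' := Finset.mem_range.1 hi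
    rcases hs with hs | hs
    · omega
    · rcases Nat.even_or_odd i with he | hod
      · rw [hs, mul_zero]
        rcases he with ⟨c, hc⟩
        exact ⟨(-s).toNat - c - 1, by omega⟩
      · rw [frobC_odd h s hs i hod, zero_mul]
  · have h1 : (n + 1 : ℂ) ≠ 0 := by exact_mod_cast Nat.succ_ne_zero n
    rw [frobC_succ, mul_div_cancel₀ _ (mul_ne_zero h1 hz)]

lemma frob_solution (h : ℕ → ℂ) {A B : ℝ} (hA : 0 ≤ A) (hB : 0 ≤ B)
    (hh : ∀ n, ‖h n‖ ≤ A * B ^ n) (s : ℤ) (hs : 0 ≤ s ∨ ∀ n, Odd n → h n = 0) :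
    ∃ (g g1 g2 : ℂ → ℂ) (ρ : ℝ), 0 < ρ ∧ g 0 = 1 ∧ ∀ z ∈ ball (0:ℂ) ρ,
      HasDerivAt g (g1 z) z ∧ HasDerivAt g1 (g2 z) z ∧
      z * g2 z + 2 * s * g1 z = z * (∑' n, h n * z ^ n) * g z := by
  set M := 1 + A + B with hMd
  have hM : 0 < M := by simp only [M]; linarith
  set a := frobC h s with had
  have ha : ∀ n, ‖a n‖ ≤ 1 * M ^ n := fun n => by
    rw [one_mul]; exact frobC_bound h s hA hB hh n
  let a1 : ℕ → ℂ := fun n => (n + 1 : ℂ) * a (n + 1)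
  have ha1 : ∀ n, ‖a1 n‖ ≤ (1 * M) * (2 * M) ^ n := powser_bound_shift hM ha
  let a2 : ℕ → ℂ := fun n => (n + 1 : ℂ) * a1 (n + 1)
  have ha2 : ∀ n, ‖a2 n‖ ≤ ((1 * M) * (2 * M)) * (2 * (2 * M)) ^ n :=
    powser_bound_shift (by positivity) ha1
  refine ⟨fun z => ∑' n, a n * z ^ n, fun z => ∑' n, a1 n * z ^ n, fun z => ∑' n, a2 n * z ^ n,
    1 / (2 * (2 * M)), by positivity, ?_, ?_⟩
  · show ∑' n, a n * 0 ^ n = 1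
    rw [tsum_eq_single 0]
    · simp [had, frobC_zero]
    · intro n hn; simp [hn]
  · intro z hz
    have hz' : (2 * (2 * M)) * ‖z‖ < 1 := by
      rw [mem_ball_zero_iff, lt_div_iff₀' (by positivity)] at hz; exact hz
    have hz2 : (2 * M) * ‖z‖ < 1 := by
      nlinarith [mul_nonneg hM.le (norm_nonneg z)]
    have hz1 : M * ‖z‖ < 1 := by
      nlinarith [mul_nonneg hM.le (norm_nonneg z)]
    refine ⟨powser_deriv hM ha hz1, powser_deriv (by positivity) ha1 hz2, ?_⟩
    have S1 := (powser_summable (by positivity) ha1 hz2).of_norm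
    have S2 := (powser_summable (by positivity) ha2 hz').of_norm
    have hh' : ∀ n, ‖h n‖ ≤ A * M ^ n := fun n => (hh n).trans (by
      gcongr; simp only [M]; linarith)
    have Sh := powser_summable hM hh' hz1
    have Sa := powser_summable hM ha hz1
    show z * (∑' n, a2 n * z ^ n) + 2 * s * (∑' n, a1 n * z ^ n) =
      z * (∑' n, h n * z ^ n) * (∑' n, a n * z ^ n)
    have e0 : 2 * (s:ℂ) * a1 0 = 0 := by
      have := frobC_rec h s hs 0
      simp only [Nat.cast_zero, zero_add, Finset.range_zero, Finset.sum_empty, one_mul] at this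
      simp only [a1, Nat.cast_zero, zero_add, one_mul]; exact this
    rw [S1.tsum_eq_zero_add, mul_assoc z, mul_comm (∑' n, h n * z ^ n),
      tsum_mul_tsum_eq_tsum_sum_range_of_summable_norm Sa Sh, mul_add, pow_zero, mul_one, e0,
      zero_add, ← tsum_mul_left, ← tsum_mul_left, ← tsum_mul_left, ← Summable.tsum_add]
    · refine tsum_congr fun n => ?_
      have hr := frobC_rec h s hs (n + 1)
      push_cast at hr
      have e : ∑ k ∈ Finset.range (n + 1), a k * z ^ k * (h (n - k) * z ^ (n - k)) =
          (∑ k ∈ Finset.range (n + 1), a k * h (n - k)) * z ^ n := by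
        rw [Finset.sum_mul]
        refine Finset.sum_congr rfl fun k hk => ?_
        have : z ^ n = z ^ k * z ^ (n - k) := by
          rw [← pow_add]; congr 1; have := Finset.mem_range.1 hk; omega
        rw [this]; ring
      rw [e, ← hr]
      simp only [a2, a1]
      push_cast
      ring
    · exact S2.mul_left z
    · exact (((summable_nat_add_iff 1).2 S1).mul_left _)

open Metric Set Filter Topology

def IsSol (q : ℂ → ℂ) (S : Set ℂ) (y : ℂ → ℂ) (z : ℂ) : Prop :=
  (z ∈ S → y z = 0 ∧ MeromorphicAt y z) ∧
  (z ∉ S → AnalyticAt ℂ y z ∧ deriv (deriv y) z = q z * y z)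

structure LocData (q : ℂ → ℂ) (S : Set ℂ) : Prop where
  closed : IsClosed S
  count : S.Countable
  isol : ∀ p, ∀ᶠ z in 𝓝[≠] p, z ∉ S
  loc : ∀ p, ∃ (k : ℕ) (h : ℂ → ℂ), AnalyticAt ℂ h 0 ∧
    (∀ᶠ x in 𝓝 (0:ℂ), x ≠ 0 → q (p + x) = k * (k + 1) / x ^ 2 + h x) ∧
    ((p ∉ S ∧ k = 0 ∧ q p = h 0) ∨ (p ∈ S ∧ ∀ᶠ x in 𝓝 (0:ℂ), h (-x) = h x))

noncomputable def wron (y1 y2 : ℂ → ℂ) (z : ℂ) : ℂ := y1 z * deriv y2 z - deriv y1 z * y2 z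

lemma IsSol.congr {q : ℂ → ℂ} {S : Set ℂ} {y y' : ℂ → ℂ} {z : ℂ} (h : y =ᶠ[𝓝 z] y')
    (hy : IsSol q S y z) : IsSol q S y' z := by
  refine ⟨fun hz => ?_, fun hz => ?_⟩
  · obtain ⟨h1, h2⟩ := hy.1 hz
    exact ⟨by rw [← h.eq_of_nhds]; exact h1, h2.congr (h.filter_mono nhdsWithin_le_nhds)⟩
  · obtain ⟨h1, h2⟩ := hy.2 hz
    exact ⟨h1.congr h, by rw [← h.deriv.deriv.eq_of_nhds, ← h.eq_of_nhds]; exact h2⟩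

lemma IsSol.comb {q : ℂ → ℂ} {S : Set ℂ} {y y' : ℂ → ℂ} {z : ℂ} (a b : ℂ)
    (hy : IsSol q S y z) (hy' : IsSol q S y' z) : IsSol q S (fun w => a * y w + b * y' w) z := by
  refine ⟨fun hz => ?_, fun hz => ?_⟩
  · obtain ⟨h1, h2⟩ := hy.1 hz
    obtain ⟨h1', h2'⟩ := hy'.1 hz
    refine ⟨by simp [h1, h1'], ?_⟩
    exact ((MeromorphicAt.const a z).fun_mul h2).fun_add ((MeromorphicAt.const b z).fun_mul h2')
  · obtain ⟨h1, h2⟩ := hy.2 hz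
    obtain ⟨h1', h2'⟩ := hy'.2 hz
    refine ⟨by fun_prop, ?_⟩
    have e : deriv (fun w => a * y w + b * y' w) =ᶠ[𝓝 z] fun w => a * deriv y w + b * deriv y' w := by
      filter_upwards [h1.eventually_analyticAt, h1'.eventually_analyticAt] with w hw hw'
      exact ((hw.differentiableAt.hasDerivAt.const_mul a).add
        (hw'.differentiableAt.hasDerivAt.const_mul b)).deriv
    rw [e.deriv_eq]
    refine ((h1.deriv.differentiableAt.hasDerivAt.const_mul a).add
        (h1'.deriv.differentiableAt.hasDerivAt.const_mul b)).deriv.trans ?_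
    rw [h2, h2']
    ring

lemma wron_deriv {q : ℂ → ℂ} {S : Set ℂ} {y y' : ℂ → ℂ} {z : ℂ} (hz : z ∉ S)
    (hy : IsSol q S y z) (hy' : IsSol q S y' z) : HasDerivAt (wron y y') 0 z := by
  obtain ⟨h1, h2⟩ := hy.2 hz
  obtain ⟨h1', h2'⟩ := hy'.2 hz
  have := (h1.differentiableAt.hasDerivAt.mul h1'.deriv.differentiableAt.hasDerivAt).sub
    (h1.deriv.differentiableAt.hasDerivAt.mul h1'.differentiableAt.hasDerivAt)
  refine this.congr_deriv ?_
  rw [h2, h2']; ring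

lemma wron_const {q : ℂ → ℂ} {S : Set ℂ} {y y' : ℂ → ℂ} {V : Set ℂ} (hV : IsOpen V)
    (hc : IsPreconnected V) (hVS : ∀ z ∈ V, z ∉ S) (hy : ∀ z ∈ V, IsSol q S y z)
    (hy' : ∀ z ∈ V, IsSol q S y' z) : ∃ c, ∀ z ∈ V, wron y y' z = c := by
  refine hV.exists_is_const_of_deriv_eq_zero hc ?_ ?_
  · intro z hz
    exact (wron_deriv (hVS z hz) (hy z hz) (hy' z hz)).differentiableAt.differentiableWithinAt
  · intro z hz
    exact (wron_deriv (hVS z hz) (hy z hz) (hy' z hz)).deriv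

/-- Expansion of a solution in a basis. -/
lemma sol_expand {q : ℂ → ℂ} {S : Set ℂ} {y y1 y2 : ℂ → ℂ} {V : Set ℂ} (hV : IsOpen V)
    (hc : IsPreconnected V) (hVS : ∀ z ∈ V, z ∉ S) (hy : ∀ z ∈ V, IsSol q S y z)
    (hy1 : ∀ z ∈ V, IsSol q S y1 z) (hy2 : ∀ z ∈ V, IsSol q S y2 z) {c : ℂ} (hc0 : c ≠ 0)
    (hw : ∀ z ∈ V, wron y1 y2 z = c) : ∃ a b : ℂ, ∀ z ∈ V, y z = a * y1 z + b * y2 z := by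
  obtain ⟨a, ha⟩ := wron_const hV hc hVS hy hy2
  obtain ⟨b, hb⟩ := wron_const hV hc hVS hy1 hy
  refine ⟨a / c, b / c, fun z hz => ?_⟩
  have h1 := ha z hz
  have h2 := hb z hz
  have h3 := hw z hz
  rw [← h1, ← h2, div_mul_eq_mul_div, div_mul_eq_mul_div, ← add_div, eq_div_iff hc0, ← h3]
  simp only [wron]; ring

lemma local_one {q : ℂ → ℂ} {p : ℂ} {k : ℕ} {h : ℂ → ℂ} (hh : AnalyticAt ℂ h 0)
    (hq : ∀ᶠ x in 𝓝 (0:ℂ), x ≠ 0 → q (p + x) = k * (k + 1) / x ^ 2 + h x) (s : ℤ)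
    (hsk : (s:ℂ) * (s - 1) = k * (k + 1)) (hs : 0 ≤ s ∨ ∀ᶠ x in 𝓝 (0:ℂ), h (-x) = h x) :
    ∃ (g g1 : ℂ → ℂ) (r : ℝ), 0 < r ∧ g 0 = 1 ∧ DifferentiableOn ℂ g (ball 0 r) ∧
      DifferentiableOn ℂ g1 (ball 0 r) ∧
      ∀ z ∈ ball p r, z ≠ p →
        deriv (fun z => (z - p) ^ s * g (z - p)) z =
          s * (z - p) ^ (s - 1) * g (z - p) + (z - p) ^ s * g1 (z - p) ∧
        deriv (deriv (fun z => (z - p) ^ s * g (z - p))) z = q z * ((z - p) ^ s * g (z - p)) := by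
  have hps := hh.hasFPowerSeriesAt
  set c : ℕ → ℂ := fun n => iteratedDeriv n h 0 / (n.factorial : ℂ) with hcdef
  obtain ⟨A, B, hA, hB, hAB⟩ := FormalMultilinearSeries.le_mul_pow_of_radius_pos _ hps.radius_pos
  have hcb : ∀ n, ‖c n‖ ≤ A * B ^ n := by
    intro n
    have := hAB n
    rwa [FormalMultilinearSeries.norm_apply_eq_norm_coef,
      FormalMultilinearSeries.coeff_ofScalars] at this
  have hs' : 0 ≤ s ∨ ∀ n, Odd n → c n = 0 := by
    refine hs.imp id fun he n hn => ?_
    have e1 : iteratedDeriv n (fun x => h (-x)) 0 = iteratedDeriv n h 0 :=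
      Filter.EventuallyEq.iteratedDeriv_eq n he
    rw [iteratedDeriv_comp_neg, neg_zero, hn.neg_one_pow] at e1
    have : iteratedDeriv n h 0 = 0 := by
      simp only [neg_smul, one_smul] at e1
      linear_combination (-1/2 : ℂ) * e1
    simp [hcdef, this]
  obtain ⟨g, g1, g2, ρ, hρ, hg0, hg⟩ := frob_solution c hA.le hB.le hcb s hs'
  have hsum := hasFPowerSeriesAt_iff.1 hps
  obtain ⟨r, hr, hball⟩ := Metric.eventually_nhds_iff_ball.1 (hsum.and hq)
  refine ⟨g, g1, min r ρ, lt_min hr hρ, hg0, ?_, ?_, ?_⟩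
  · intro z hz
    exact (hg z (ball_subset_ball (min_le_right _ _) hz)).1.differentiableAt.differentiableWithinAt
  · intro z hz
    exact (hg z (ball_subset_ball (min_le_right _ _) hz)).2.1.differentiableAt.differentiableWithinAt
  -- in coordinate x
  have D1 : ∀ x ∈ ball (0:ℂ) (min r ρ), x ≠ 0 →
      HasDerivAt (fun x => x ^ s * g x) (s * x ^ (s - 1) * g x + x ^ s * g1 x) x := by
    intro x hx hx0
    exact (hasDerivAt_zpow s x (Or.inl hx0)).mul (hg x (ball_subset_ball (min_le_right _ _) hx)).1
  have D2 : ∀ x ∈ ball (0:ℂ) (min r ρ), x ≠ 0 →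
      deriv (deriv (fun x => x ^ s * g x)) x = q (p + x) * (x ^ s * g x) := by
    intro x hx hx0
    have e : deriv (fun x => x ^ s * g x) =ᶠ[𝓝 x]
        fun x => s * x ^ (s - 1) * g x + x ^ s * g1 x := by
      filter_upwards [isOpen_ball.mem_nhds hx, isOpen_ne.mem_nhds hx0] with w hw hw0
      exact (D1 w hw hw0).deriv
    rw [e.deriv_eq]
    obtain ⟨a1, a2, a3⟩ := hg x (ball_subset_ball (min_le_right _ _) hx)
    have := ((((hasDerivAt_zpow (s - 1) x (Or.inl hx0)).const_mul (s:ℂ)).mul a1).add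
      ((hasDerivAt_zpow s x (Or.inl hx0)).mul a2)).deriv
    refine this.trans ?_
    obtain ⟨b1, b2⟩ := hball x (ball_subset_ball (min_le_left _ _) hx)
    rw [b2 hx0]
    have b3 : ∑' n, c n * x ^ n = h x := by
      rw [zero_add] at b1
      rw [← b1.tsum_eq]
      refine tsum_congr fun n => ?_
      rw [FormalMultilinearSeries.coeff_ofScalars, smul_eq_mul, mul_comm]
    rw [b3] at a3
    have z1 : x ^ (s - 1) = x ^ s / x := by rw [zpow_sub_one₀ hx0]; rfl
    have z2 : x ^ (s - 1 - 1) = x ^ s / x ^ 2 := by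
      rw [zpow_sub_one₀ hx0, zpow_sub_one₀ hx0]; field_simp
    rw [z1, z2]
    push_cast
    have hx2 : x ^ 2 ≠ 0 := pow_ne_zero 2 hx0
    field_simp
    linear_combination (g x) * hsk + x * a3
  intro z hz hzp
  have hx : z - p ∈ ball (0:ℂ) (min r ρ) := by
    rwa [mem_ball_zero_iff, ← dist_eq_norm]
  have hx0 : z - p ≠ 0 := sub_ne_zero.2 hzp
  constructor
  · rw [deriv_comp_sub_const (f := fun x => x ^ s * g x)]
    exact (D1 _ hx hx0).deriv
  · have e : deriv (fun z => (z - p) ^ s * g (z - p)) =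
        fun z => deriv (fun x => x ^ s * g x) (z - p) := by
      funext w; exact deriv_comp_sub_const (f := fun x => x ^ s * g x) ..
    rw [e, deriv_comp_sub_const (f := deriv (fun x => x ^ s * g x)), D2 _ hx hx0]
    congr 2; ring

open Metric Set Filter Topology

lemma local_sol {q : ℂ → ℂ} {S : Set ℂ} (H : LocData q S) {p : ℂ} {k : ℕ} {h : ℂ → ℂ}
    (hh : AnalyticAt ℂ h 0)
    (hq : ∀ᶠ x in 𝓝 (0:ℂ), x ≠ 0 → q (p + x) = k * (k + 1) / x ^ 2 + h x)
    (hp : (p ∉ S ∧ k = 0 ∧ q p = h 0) ∨ (p ∈ S ∧ ∀ᶠ x in 𝓝 (0:ℂ), h (-x) = h x))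
    (s : ℤ) (hsk : (s:ℂ) * (s - 1) = k * (k + 1)) (hs : 0 ≤ s ∨ p ∈ S) :
    ∃ (y g g1 : ℂ → ℂ) (r : ℝ), 0 < r ∧ g 0 = 1 ∧ ContinuousAt g 0 ∧ ContinuousAt g1 0 ∧
      (∀ z ∈ ball p r, IsSol q S y z) ∧ 
      ∀ z ∈ ball p r, z ≠ p → z ∉ S ∧ y z = (z - p) ^ s * g (z - p) ∧
        deriv y z = s * (z - p) ^ (s - 1) * g (z - p) + (z - p) ^ s * g1 (z - p) := by
  classical
  have hs' : 0 ≤ s ∨ ∀ᶠ x in 𝓝 (0:ℂ), h (-x) = h x := by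
    rcases hs with hs | hs
    · exact Or.inl hs
    · rcases hp with hp | hp
      · exact absurd hs hp.1
      · exact Or.inr hp.2
  obtain ⟨g, g1, r1, hr1, hg0, hgd, hg1d, hF⟩ := local_one hh hq s hsk hs'
  have := H.isol p
  rw [eventually_nhdsWithin_iff, Metric.eventually_nhds_iff_ball] at this
  obtain ⟨r2, hr2, hS⟩ := this
  set F : ℂ → ℂ := fun z => (z - p) ^ s * g (z - p) with hFdef
  set y : ℂ → ℂ := fun z => if z ∈ S then 0 else F z with hy
  have yF : ∀ z, z ∉ S → y =ᶠ[𝓝 z] F := by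
    intro z hz
    filter_upwards [H.closed.isOpen_compl.mem_nhds hz] with w hw
    exact if_neg hw
  have gA : AnalyticAt ℂ g 0 := hgd.analyticAt (isOpen_ball.mem_nhds (mem_ball_self hr1))
  have memx : ∀ z ∈ ball p r1, z - p ∈ ball (0:ℂ) r1 := fun z hz => by
    rwa [mem_ball_zero_iff, ← dist_eq_norm]
  have FA : ∀ z ∈ ball p r1, z ≠ p → AnalyticAt ℂ F z := by
    intro z hz hzp
    have a1 : AnalyticAt ℂ g (z - p) := hgd.analyticAt (isOpen_ball.mem_nhds (memx z hz))
    have a2 : AnalyticAt ℂ (fun w => g (w - p)) z :=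
      AnalyticAt.fun_comp (g := g) (f := fun w => w - p) a1 (by fun_prop)
    have a3 : AnalyticAt ℂ (fun w : ℂ => (w - p) ^ s) z :=
      AnalyticAt.fun_zpow (by fun_prop) (sub_ne_zero.2 hzp)
    exact a3.mul a2
  have gA' : AnalyticAt ℂ (fun w => g (w - p)) p := by
    refine AnalyticAt.fun_comp (g := g) (f := fun w => w - p) ?_ (by fun_prop)
    simpa using gA
  refine ⟨y, g, g1, min r1 r2, lt_min hr1 hr2, hg0, gA.continuousAt,
    (hg1d.differentiableAt (isOpen_ball.mem_nhds (mem_ball_self hr1))).continuousAt, ?_, ?_⟩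
  · intro z hz
    have hz1 := ball_subset_ball (min_le_left _ _) hz
    have hz2 := ball_subset_ball (min_le_right _ _) hz
    by_cases hzp : z = p
    · subst hzp
      refine ⟨fun hzS => ⟨if_pos hzS, ?_⟩, fun hzS => ?_⟩
      · have : MeromorphicAt F z := by
          refine MeromorphicAt.fun_mul (MeromorphicAt.fun_zpow ?_ s) gA'.meromorphicAt
          exact AnalyticAt.meromorphicAt (by fun_prop)
        refine this.congr ?_
        filter_upwards [H.isol z] with w hw
        exact (if_neg hw).symm
      · have hs0 : 0 ≤ s := hs.resolve_right hzS
        obtain ⟨_, hk, hqh⟩ := hp.resolve_right fun h => hzS h.1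
        have FAz : AnalyticAt ℂ F z := by
          have a3 : AnalyticAt ℂ (fun w : ℂ => (w - z) ^ s) z := by
            lift s to ℕ using hs0
            simp only [zpow_natCast]
            fun_prop
          exact a3.mul gA'
        refine ⟨FAz.congr (yF z hzS).symm, ?_⟩
        rw [(yF z hzS).deriv.deriv_eq, (yF z hzS).eq_of_nhds, hqh]
        have c1 : ContinuousAt (deriv (deriv F)) z := FAz.deriv.deriv.continuousAt
        have c2 : ContinuousAt (fun w => h (w - z) * F w) z := by
          refine ContinuousAt.mul ?_ FAz.continuousAt
          refine ContinuousAt.comp' (g := h) ?_ (by fun_prop)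
          simpa using hh.continuousAt
        have e : deriv (deriv F) =ᶠ[𝓝[≠] z] (fun w => h (w - z) * F w) := by
          have q' : ∀ᶠ w in 𝓝 z, w - z ≠ 0 → q (z + (w - z)) = k * (k + 1) / (w - z) ^ 2 + h (w - z) := by
            have t : Tendsto (fun w => w - z) (𝓝 z) (𝓝 0) := by
              have : ContinuousAt (fun w => w - z) z := by fun_prop
              simpa [ContinuousAt] using this
            exact t.eventually hq
          filter_upwards [self_mem_nhdsWithin, mem_nhdsWithin_of_mem_nhds q',
            mem_nhdsWithin_of_mem_nhds (isOpen_ball.mem_nhds hz1)] with w hw hw2 hw3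
          rw [(hF w hw3 hw).2]
          have := hw2 (sub_ne_zero.2 hw)
          simp only [hk, add_sub_cancel] at this
          rw [this]; simp [hFdef]
        have := tendsto_nhds_unique_of_eventuallyEq (c1.mono_left nhdsWithin_le_nhds)
          (c2.mono_left nhdsWithin_le_nhds) e
        simpa using this
    · have hzS := hS z hz2 hzp
      refine ⟨fun h => absurd h hzS, fun _ => ?_⟩
      refine ⟨(FA z hz1 hzp).congr (yF z hzS).symm, ?_⟩
      rw [(yF z hzS).deriv.deriv_eq, (yF z hzS).eq_of_nhds]
      exact (hF z hz1 hzp).2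
  · intro z hz hzp
    have hz1 := ball_subset_ball (min_le_left _ _) hz
    have hz2 := ball_subset_ball (min_le_right _ _) hz
    have hzS := hS z hz2 hzp
    refine ⟨hzS, if_neg hzS, ?_⟩
    rw [(yF z hzS).deriv_eq]
    exact (hF z hz1 hzp).1

lemma local_sols {q : ℂ → ℂ} {S : Set ℂ} (H : LocData q S) (p : ℂ) :
    ∃ (r : ℝ) (y1 y2 : ℂ → ℂ) (c : ℂ), 0 < r ∧ c ≠ 0 ∧ (∀ z ∈ ball p r, IsSol q S y1 z) ∧
      (∀ z ∈ ball p r, IsSol q S y2 z) ∧ ∀ z ∈ ball p r \ S, wron y1 y2 z = c := by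
  obtain ⟨k, h, hh, hq, hp⟩ := H.loc p
  obtain ⟨y1, g, g1, r1, hr1, hg0, gc, g1c, hy1, hf1⟩ := local_sol H hh hq hp (-(k:ℤ))
    (by push_cast; ring) (by
      rcases hp with hp | hp
      · left; simp [hp.2.1]
      · exact Or.inr hp.1)
  obtain ⟨y2, G, G1, r2, hr2, hG0, Gc, G1c, hy2, hf2⟩ := local_sol H hh hq hp ((k:ℤ) + 1)
    (by push_cast; ring) (Or.inl (by positivity))
  have s1 : ball p (min r1 r2) ⊆ ball p r1 := ball_subset_ball (min_le_left _ _)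
  have s2 : ball p (min r1 r2) ⊆ ball p r2 := ball_subset_ball (min_le_right _ _)
  have hr := lt_min hr1 hr2
  obtain ⟨c, hc⟩ := wron_const (q := q) (S := S) (y := y1) (y' := y2)
    (V := ball p (min r1 r2) \ S) (isOpen_ball.sdiff H.closed)
    (convex_diff_countable_preconn isOpen_ball (convex_ball _ _) H.count) (fun z hz => hz.2)
    (fun z hz => hy1 z (s1 hz.1)) (fun z hz => hy2 z (s2 hz.1))
  refine ⟨min r1 r2, y1, y2, c, hr, ?_, fun z hz => hy1 z (s1 hz), fun z hz => hy2 z (s2 hz), hc⟩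
  let Φ : ℂ → ℂ := fun x => (2 * k + 1) * (g x * G x) + x * (g x * G1 x - g1 x * G x)
  have hΦ : ContinuousAt (fun z => Φ (z - p)) p := by
    refine ContinuousAt.comp' (g := Φ) ?_ (by fun_prop)
    rw [sub_self]; fun_prop
  have e : (fun z => Φ (z - p)) =ᶠ[𝓝[≠] p] fun _ => c := by
    filter_upwards [self_mem_nhdsWithin,
      mem_nhdsWithin_of_mem_nhds (isOpen_ball.mem_nhds (mem_ball_self hr))] with z hzp hz
    obtain ⟨hS, e1, e2⟩ := hf1 z (s1 hz) hzp
    obtain ⟨_, e3, e4⟩ := hf2 z (s2 hz) hzp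
    rw [← hc z ⟨hz, hS⟩, wron, e1, e2, e3, e4]
    have hx : z - p ≠ 0 := sub_ne_zero.2 hzp
    generalize z - p = x at hx
    simp only [Φ]
    have z1 : x ^ (-(k:ℤ) - 1) = (x ^ k)⁻¹ * x⁻¹ := by rw [zpow_sub_one₀ hx, zpow_neg, zpow_natCast]
    have z2 : x ^ (-(k:ℤ)) = (x ^ k)⁻¹ := by rw [zpow_neg, zpow_natCast]
    have z3 : x ^ ((k:ℤ) + 1 - 1) = x ^ k := by rw [add_sub_cancel_right, zpow_natCast]
    have z4 : x ^ ((k:ℤ) + 1) = x ^ k * x := by rw [zpow_add_one₀ hx, zpow_natCast]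
    rw [z1, z2, z3, z4]
    have hk : x ^ k ≠ 0 := pow_ne_zero _ hx
    push_cast
    field_simp
    ring
  have := tendsto_nhds_unique_of_eventuallyEq (hΦ.mono_left nhdsWithin_le_nhds)
          tendsto_const_nhds e
  rw [← this]
  simp only [Φ, sub_self, hg0, hG0, mul_one, zero_mul, add_zero]
  exact_mod_cast (by omega : 2 * k + 1 ≠ 0)

open Metric Set Filter Topology

lemma sol_unique {q : ℂ → ℂ} {S : Set ℂ} (H : LocData q S) (Y Y' : ℂ → ℂ) (U : Set ℂ) (z : ℂ)
    (hU : IsOpen U) (hc : Convex ℝ U) (hz : z ∈ U) (hY : ∀ w ∈ U, IsSol q S Y w)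
    (hY' : ∀ w ∈ U, IsSol q S Y' w) (e : Y =ᶠ[𝓝 z] Y') : EqOn Y Y' U := by
  obtain ⟨w, ⟨hw1, hw2⟩, hw3⟩ : ∃ w, (Y =ᶠ[𝓝 w] Y' ∧ w ∈ U) ∧ w ∉ S := by
    have h1 : ∀ᶠ w in 𝓝[≠] z, (Y =ᶠ[𝓝 w] Y' ∧ w ∈ U) :=
      mem_nhdsWithin_of_mem_nhds (e.eventually_nhds.and (hU.mem_nhds hz))
    exact (h1.and (H.isol z)).exists
  have := AnalyticOnNhd.eqOn_of_preconnected_of_eventuallyEq (𝕜 := ℂ) (f := Y) (g := Y')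
    (U := U \ S) (fun x hx => ((hY x hx.1).2 hx.2).1) (fun x hx => ((hY' x hx.1).2 hx.2).1)
    (convex_diff_countable_preconn hU hc H.count) ⟨hw2, hw3⟩ hw1
  intro x hx
  by_cases hxS : x ∈ S
  · rw [((hY x hx).1 hxS).1, ((hY' x hx).1 hxS).1]
  · exact this ⟨hx, hxS⟩

lemma glob_one {q : ℂ → ℂ} {S : Set ℂ} (H : LocData q S) (Y₀ : ℂ → ℂ) (r₀ : ℝ) (hr₀ : 0 < r₀)
    (hY₀ : ∀ z ∈ ball 0 r₀, IsSol q S Y₀ z) :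
    ∃ Y, (∀ z, IsSol q S Y z) ∧ Y =ᶠ[𝓝 0] Y₀ := by
  refine plane_glue (IsSol q S) (fun Y Y' z e h => h.congr e) ?_ (sol_unique H) Y₀ r₀ hr₀ hY₀
  intro p
  obtain ⟨r, y1, y2, c, hr, hc, h1, h2, hw⟩ := local_sols H p
  refine ⟨r, hr, fun Y U hU hUc _ hY => ?_⟩
  obtain ⟨a, b, hab⟩ := sol_expand (q := q) (S := S) (V := (U ∩ ball p r) \ S) (y := Y) (y1 := y1)
    (y2 := y2) ((hU.inter isOpen_ball).sdiff H.closed)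
    (convex_diff_countable_preconn (hU.inter isOpen_ball) (hUc.inter (convex_ball _ _)) H.count)
    (fun z hz => hz.2) (fun z hz => hY z hz.1) (fun z hz => h1 z hz.1.2) (fun z hz => h2 z hz.1.2)
    hc (fun z hz => hw z ⟨hz.1.2, hz.2⟩)
  refine ⟨fun z => a * y1 z + b * y2 z, fun z hz => (h1 z hz).comb a b (h2 z hz), ?_⟩
  intro z hz
  by_cases hzS : z ∈ S
  · simp only
    rw [((hY z hz).1 hzS).1, ((h1 z hz.2).1 hzS).1, ((h2 z hz.2).1 hzS).1]; ring
  · exact hab z ⟨hz, hzS⟩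

lemma compl_preconn {q : ℂ → ℂ} {S : Set ℂ} (H : LocData q S) : IsPreconnected (univ \ S) :=
  convex_diff_countable_preconn isOpen_univ convex_univ H.count

lemma glob_sols {q : ℂ → ℂ} {S : Set ℂ} (H : LocData q S) :
    ∃ (y1 y2 : ℂ → ℂ) (c : ℂ), c ≠ 0 ∧ (∀ z, IsSol q S y1 z) ∧ (∀ z, IsSol q S y2 z) ∧
      ∀ z ∉ S, wron y1 y2 z = c := by
  obtain ⟨r, y1, y2, c, hr, hc, h1, h2, hw⟩ := local_sols H 0
  obtain ⟨Y1, hY1, e1⟩ := glob_one H y1 r hr h1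
  obtain ⟨Y2, hY2, e2⟩ := glob_one H y2 r hr h2
  obtain ⟨C, hC⟩ := wron_const (q := q) (S := S) (y := Y1) (y' := Y2)
    (V := univ \ S) (isOpen_univ.sdiff H.closed) (compl_preconn H) (fun z hz => hz.2)
    (fun z _ => hY1 z) (fun z _ => hY2 z)
  refine ⟨Y1, Y2, C, ?_, hY1, hY2, fun z hz => hC z ⟨mem_univ _, hz⟩⟩
  have h3 : ∀ᶠ w in 𝓝[≠] (0:ℂ), ((Y1 =ᶠ[𝓝 w] y1 ∧ Y2 =ᶠ[𝓝 w] y2) ∧ w ∈ ball 0 r) :=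
      mem_nhdsWithin_of_mem_nhds ((e1.eventually_nhds.and e2.eventually_nhds).and
        (isOpen_ball.mem_nhds (mem_ball_self hr)))
  obtain ⟨w, ⟨⟨a1, a2⟩, a3⟩, a4⟩ := (h3.and (H.isol 0)).exists
  rw [← hC w ⟨mem_univ _, a4⟩, wron, a1.deriv_eq, a2.deriv_eq, a1.eq_of_nhds, a2.eq_of_nhds]
  have := hw w ⟨a3, a4⟩
  rw [wron] at this
  rwa [this]

lemma glob_expand {q : ℂ → ℂ} {S : Set ℂ} (H : LocData q S) {y1 y2 y : ℂ → ℂ} {c : ℂ} (hc : c ≠ 0)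
    (h1 : ∀ z, IsSol q S y1 z) (h2 : ∀ z, IsSol q S y2 z) (hw : ∀ z ∉ S, wron y1 y2 z = c)
    (hy : ∀ z, z ∉ S → AnalyticAt ℂ y z ∧ deriv (deriv y) z = q z * y z) :
    ∃ a b : ℂ, ∀ z ∉ S, y z = a * y1 z + b * y2 z := by
  obtain ⟨a, b, hab⟩ := sol_expand (q := q) (S := S) (V := univ \ S) (y := y) (y1 := y1)
    (y2 := y2) (isOpen_univ.sdiff H.closed) (compl_preconn H) (fun z hz => hz.2)
    (fun z hz => ⟨fun h => absurd h hz.2, fun h => hy z h⟩)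
    (fun z _ => h1 z) (fun z _ => h2 z) hc (fun z hz => hw z hz.2)
  exact ⟨a, b, fun z hz => hab z ⟨mem_univ _, hz⟩⟩

open Metric Set Filter Topology

lemma tau_indep {τ : ℂ} (hτ : 0 < τ.im) {c : ℂ} (hc : c ≠ 0) :
    LinearIndependent ℝ ![c, c * τ] := by
  rw [LinearIndependent.pair_iff]
  intro s t h
  have h2 : (s : ℂ) + t * τ = 0 := by
    have : c * ((s : ℂ) + t * τ) = 0 := by
      rw [← h]; simp only [Complex.real_smul]; ring
    exact (mul_eq_zero.1 this).resolve_left hc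
  have him := congrArg Complex.im h2
  have hre := congrArg Complex.re h2
  simp at him hre
  rcases him with him | him
  · subst him; simpa using hre
  · exact absurd him hτ.ne'

noncomputable def tauPair (τ : ℂ) (hτ : 0 < τ.im) (c : ℂ) (hc : c ≠ 0) : PeriodPair :=
  ⟨c, c * τ, tau_indep hτ hc⟩

lemma lat_int {τ : ℂ} (hτ : 0 < τ.im) {a b : ℤ} (h : (a : ℂ) + b * τ = 0) : a = 0 ∧ b = 0 := by
  have him := congrArg Complex.im h
  have hre := congrArg Complex.re h
  simp at him hre
  rcases him with him | him
  · subst him; simpa using hre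
  · exact absurd him hτ.ne'

lemma lat_add {τ a b : ℂ} (ha : a ∈ lat τ) (hb : b ∈ lat τ) : a + b ∈ lat τ := by
  obtain ⟨m, n, rfl⟩ := ha
  obtain ⟨m', n', rfl⟩ := hb
  exact ⟨m + m', n + n', by push_cast; ring⟩

lemma lat_neg {τ a : ℂ} (ha : a ∈ lat τ) : -a ∈ lat τ := by
  obtain ⟨m, n, rfl⟩ := ha
  exact ⟨-m, -n, by push_cast; ring⟩

lemma lat_one (τ : ℂ) : (1:ℂ) ∈ lat τ := ⟨1, 0, by simp⟩
lemma lat_tau (τ : ℂ) : τ ∈ lat τ := ⟨0, 1, by simp⟩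
lemma lat_per (τ : ℂ) (k : Fin 4) : per τ (k : ℕ) ∈ lat τ := by
  fin_cases k
  · exact ⟨0, 0, by simp [per]⟩
  · exact ⟨1, 0, by simp [per]⟩
  · exact ⟨0, 1, by simp [per]⟩
  · exact ⟨1, 1, by simp [per]⟩

lemma per_diff {τ : ℂ} (hτ : 0 < τ.im) {j k : Fin 4}
    (h : per τ (k : ℕ) / 2 - per τ (j : ℕ) / 2 ∈ lat τ) : j = k := by
  obtain ⟨m, n, h⟩ := h
  have key : ∀ a b : ℤ, per τ (k : ℕ) - per τ (j : ℕ) = a + b * τ → a = 2 * m ∧ b = 2 * n := by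
    intro a b hab
    have := lat_int hτ (a := a - 2 * m) (b := b - 2 * n) (by
      push_cast; linear_combination 2 * h - hab)
    omega
  fin_cases j <;> fin_cases k <;> first | rfl | skip
  · have := key 1 0 (by simp [per]); omega
  · have := key 0 1 (by simp [per]); omega
  · have := key 1 1 (by simp [per]); omega
  · have := key (-1) 0 (by simp [per]); omega
  · have := key (-1) 1 (by simp [per]; ring); omega
  · have := key 0 1 (by simp [per]); omega
  · have := key 0 (-1) (by simp [per]); omega
  · have := key 1 (-1) (by simp [per]; ring); omega
  · have := key 1 0 (by simp [per]); omega
  · have := key (-1) (-1) (by simp [per]; ring); omega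
  · have := key 0 (-1) (by simp [per]); omega
  · have := key (-1) 0 (by simp [per]); omega


lemma lat_eq {τ : ℂ} (hτ : 0 < τ.im) : lat τ = ((tauPair τ hτ 1 one_ne_zero).lattice : Set ℂ) := by
  ext z
  simp only [lat, mem_ofPred_eq, SetLike.mem_coe, PeriodPair.mem_lattice, tauPair, mul_one, one_mul]
  exact ⟨fun ⟨m, n, h⟩ => ⟨m, n, h.symm⟩, fun ⟨m, n, h⟩ => ⟨m, n, h.symm⟩⟩

lemma wp_eq {τ : ℂ} (hτ : 0 < τ.im) (z : ℂ) : wp τ z = 1 / z ^ 2 +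
    (tauPair τ hτ 1 one_ne_zero).weierstrassPExcept 0 z := by
  rw [wp, PeriodPair.weierstrassPExcept]
  congr 1
  set L := tauPair τ hτ 1 one_ne_zero
  rw [← L.latticeEquivProd.symm.toEquiv.tsum_eq]
  have e : ∀ p : ℤ × ℤ, ((L.latticeEquivProd.symm.toEquiv p : L.lattice) : ℂ) = latPt τ p := by
    intro p
    have := L.latticeEquiv_symm_apply p
    simp only [LinearEquiv.coe_toEquiv]
    rw [this]; simp [latPt, L, tauPair]
  simp only [e]
  refine (tsum_subtype {p : ℤ × ℤ | p ≠ 0} (fun p => 1 / (z - latPt τ p) ^ 2 - 1 / latPt τ p ^ 2)).trans ?_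
  refine tsum_congr fun p => ?_
  by_cases hp : p = 0
  · simp [hp, latPt]
  · rw [indicator_of_mem (by exact hp), if_neg]
    intro h
    have := lat_int hτ (a := p.1) (b := p.2) h
    exact hp (Prod.ext this.1 this.2)

lemma wp_eq' {τ : ℂ} (hτ : 0 < τ.im) (z : ℂ) : wp τ z = (tauPair τ hτ 1 one_ne_zero).weierstrassP z := by
  rw [wp_eq hτ, ← PeriodPair.weierstrassPExcept_add _ 0]
  simp; ring

lemma wp_per {τ : ℂ} (hτ : 0 < τ.im) {l : ℂ} (hl : l ∈ lat τ) (z : ℂ) : wp τ (z + l) = wp τ z := by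
  rw [lat_eq hτ] at hl
  rw [wp_eq' hτ, wp_eq' hτ]
  exact PeriodPair.weierstrassP_add_coe _ z ⟨l, hl⟩

lemma wp_even {τ : ℂ} (hτ : 0 < τ.im) (z : ℂ) : wp τ (-z) = wp τ z := by
  rw [wp_eq' hτ, wp_eq' hτ, PeriodPair.weierstrassP_neg]

lemma wp_an {τ : ℂ} (hτ : 0 < τ.im) {z : ℂ} (hz : z ∉ lat τ) : AnalyticAt ℂ (wp τ) z := by
  have : wp τ = (tauPair τ hτ 1 one_ne_zero).weierstrassP := funext (wp_eq' hτ)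
  rw [this]
  refine PeriodPair.analyticOnNhd_weierstrassP _ z ?_
  rw [lat_eq hτ] at hz
  exact hz

lemma wp_pole {τ : ℂ} (hτ : 0 < τ.im) : ∃ h, AnalyticAt ℂ h 0 ∧ ∀ x, wp τ x = 1 / x ^ 2 + h x :=
  ⟨_, PeriodPair.analyticOnNhd_weierstrassPExcept _ 0 0 (by simp), wp_eq hτ⟩

lemma sing_sub {τ : ℂ} (hτ : 0 < τ.im) (m : Fin 4 → ℕ) : singSet τ m ⊆
    ((tauPair τ hτ (1/2) (by norm_num)).lattice : Set ℂ) := by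
  rintro z ⟨k, _, l, ⟨a, b, rfl⟩, rfl⟩
  obtain ⟨a', b', h⟩ := lat_per τ k
  rw [h]
  simp only [SetLike.mem_coe, PeriodPair.mem_lattice, tauPair]
  exact ⟨a' + 2 * a, b' + 2 * b, by push_cast; ring⟩

lemma sing_isol {τ : ℂ} (hτ : 0 < τ.im) (m : Fin 4 → ℕ) (p : ℂ) : ∀ᶠ z in 𝓝[≠] p, z ∉ singSet τ m := by
  filter_upwards [mem_nhdsWithin_of_mem_nhds
    (PeriodPair.compl_lattice_sdiff_singleton_mem_nhds (tauPair τ hτ (1/2) (by norm_num)) p),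
    self_mem_nhdsWithin] with z hz hzp hzS
  exact hz ⟨sing_sub hτ m hzS, hzp⟩

lemma sing_closed {τ : ℂ} (hτ : 0 < τ.im) (m : Fin 4 → ℕ) : IsClosed (singSet τ m) :=
  PeriodPair.isClosed_of_subset_lattice _ (sing_sub hτ m)

lemma sing_count {τ : ℂ} (m : Fin 4 → ℕ) : (singSet τ m).Countable := by
  have : singSet τ m ⊆ range (fun p : Fin 4 × ℤ × ℤ =>
      per τ (p.1 : ℕ) / 2 + ((p.2.1 : ℂ) + (p.2.2 : ℂ) * τ)) := by
    rintro z ⟨k, _, l, ⟨a, b, rfl⟩, rfl⟩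
    exact ⟨(k, a, b), rfl⟩
  exact (countable_range _).mono this

lemma sing_add {τ : ℂ} {m : Fin 4 → ℕ} {l : ℂ} (hl : l ∈ lat τ) (z : ℂ) :
    z + l ∈ singSet τ m ↔ z ∈ singSet τ m := by
  constructor
  · rintro ⟨k, hk, l', hl', h⟩
    exact ⟨k, hk, l' + -l, lat_add hl' (lat_neg hl), by linear_combination h⟩
  · rintro ⟨k, hk, l', hl', h⟩
    exact ⟨k, hk, l' + l, lat_add hl' hl, by linear_combination h⟩

lemma sing_neg {τ : ℂ} {m : Fin 4 → ℕ} (z : ℂ) : -z ∈ singSet τ m ↔ z ∈ singSet τ m := by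
  have key : ∀ z, z ∈ singSet τ m → -z ∈ singSet τ m := by
    rintro z ⟨k, hk, l', hl', h⟩
    exact ⟨k, hk, -(l' + per τ k), lat_neg (lat_add hl' (lat_per τ k)), by rw [h]; ring⟩
  exact ⟨fun h => by simpa using key _ h, key z⟩


noncomputable def heunQ (τ : ℂ) (m : Fin 4 → ℕ) (E : ℂ) (z : ℂ) : ℂ :=
  (∑ j : Fin 4, (m j : ℂ) * ((m j : ℂ) + 1) * wp τ (z - per τ (j : ℕ) / 2)) - E

lemma heunQ_per {τ : ℂ} (hτ : 0 < τ.im) (m : Fin 4 → ℕ) (E : ℂ) {l : ℂ} (hl : l ∈ lat τ) (z : ℂ) :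
    heunQ τ m E (z + l) = heunQ τ m E z := by
  unfold heunQ
  congr 1
  refine Finset.sum_congr rfl fun j _ => ?_
  rw [← wp_per hτ hl (z - _)]
  congr 2; ring

lemma heunQ_even {τ : ℂ} (hτ : 0 < τ.im) (m : Fin 4 → ℕ) (E : ℂ) (z : ℂ) :
    heunQ τ m E (-z) = heunQ τ m E z := by
  unfold heunQ
  congr 1
  refine Finset.sum_congr rfl fun j _ => ?_
  rw [← wp_per hτ (lat_per τ j) (z - _), ← wp_even hτ]
  congr 2; ring

lemma heun_loc {τ : ℂ} (hτ : 0 < τ.im) (m : Fin 4 → ℕ) (E : ℂ) :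
    LocData (heunQ τ m E) (singSet τ m) := by
  refine ⟨sing_closed hτ m, sing_count m, sing_isol hτ m, fun p => ?_⟩
  by_cases hp : p ∈ singSet τ m
  · have hp' := hp
    obtain ⟨k, hk, l, hl, rfl⟩ := hp'
    set p := per τ (k : ℕ) / 2 + l with hpdef
    obtain ⟨H, hH, hHe⟩ := wp_pole hτ
    let h : ℂ → ℂ := fun x => (∑ j : Fin 4, (m j : ℂ) * ((m j : ℂ) + 1) *
      (if j = k then H x else wp τ (p + x - per τ (j : ℕ) / 2))) - E
    have hqe : ∀ x, heunQ τ m E (p + x) = (m k) * (m k + 1) / x ^ 2 + h x := by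
      intro x
      simp only [heunQ, h]
      rw [← add_sub_assoc]
      congr 1
      have : ((m k : ℂ)) * (m k + 1) / x ^ 2 =
          ∑ j : Fin 4, if j = k then ((m k : ℂ)) * (m k + 1) / x ^ 2 else 0 := by simp
      rw [this, ← Finset.sum_add_distrib]
      refine Finset.sum_congr rfl fun j _ => ?_
      by_cases hj : j = k
      · subst hj
        simp only [if_true]
        have : p + x - per τ (j : ℕ) / 2 = x + l := by rw [hpdef]; ring
        rw [this, wp_per hτ hl, hHe]; ring
      · simp [hj]
    refine ⟨m k, h, ?_, Eventually.of_forall fun x _ => hqe x, Or.inr ⟨hp, ?_⟩⟩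
    · refine AnalyticAt.sub ?_ analyticAt_const
      refine Finset.univ.analyticAt_fun_sum fun j _ => ?_
      refine analyticAt_const.mul ?_
      by_cases hj : j = k
      · simpa [hj] using hH
      · simp only [hj, if_false]
        refine AnalyticAt.fun_comp (g := wp τ) (f := fun x => p + x - per τ (j : ℕ) / 2) ?_
          (by fun_prop)
        refine wp_an hτ fun hmem => hj (per_diff hτ ?_)
        have := lat_add hmem (lat_neg hl)
        convert this using 1
        rw [hpdef]; ring
    · refine Eventually.of_forall fun x => ?_
      by_cases hx : x = 0
      · simp [hx]
      have h1 := hqe x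
      have h2 := hqe (-x)
      have h3 : heunQ τ m E (p + -x) = heunQ τ m E (p + x) := by
        rw [← heunQ_even hτ]
        rw [← heunQ_per hτ m E (lat_add (lat_per τ k) (lat_add hl hl))]
        congr 1; rw [hpdef]; ring
      rw [h1, h2] at h3
      simpa using h3
  · refine ⟨0, fun x => heunQ τ m E (p + x), ?_, ?_, Or.inl ⟨hp, rfl, by simp⟩⟩
    · refine AnalyticAt.sub ?_ analyticAt_const
      refine Finset.univ.analyticAt_fun_sum fun j _ => ?_
      rcases Nat.eq_zero_or_pos (m j) with hj | hj
      · simp only [hj, Nat.cast_zero, zero_mul]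
        exact analyticAt_const
      · refine analyticAt_const.mul ?_
        refine AnalyticAt.fun_comp (g := wp τ) (f := fun x => p + x - per τ (j : ℕ) / 2) ?_
          (by fun_prop)
        refine wp_an hτ fun hmem => hp ⟨j, hj, _, hmem, ?_⟩
        ring
    · simp

open Metric Set Filter Topology ComplexConjugate

noncomputable def wbar (g : ℂ → ℂ) (z : ℂ) : ℂ :=
  (1 / 2) * (fderiv ℝ g z (1 : ℂ) + Complex.I * fderiv ℝ g z Complex.I)

lemma wirt_mul {g h : ℂ → ℂ} {z : ℂ} (hg : DifferentiableAt ℝ g z) (hh : DifferentiableAt ℝ h z) :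
    wirt (fun x => g x * h x) z = wirt g z * h z + g z * wirt h z := by
  simp only [wirt, fderiv_fun_mul hg hh]
  simp; ring

lemma wbar_mul {g h : ℂ → ℂ} {z : ℂ} (hg : DifferentiableAt ℝ g z) (hh : DifferentiableAt ℝ h z) :
    wbar (fun x => g x * h x) z = wbar g z * h z + g z * wbar h z := by
  simp only [wbar, fderiv_fun_mul hg hh]
  simp; ring

lemma wirt_add {g h : ℂ → ℂ} {z : ℂ} (hg : DifferentiableAt ℝ g z) (hh : DifferentiableAt ℝ h z) :
    wirt (fun x => g x + h x) z = wirt g z + wirt h z := by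
  simp only [wirt, fderiv_fun_add hg hh]
  simp; ring

lemma wbar_add {g h : ℂ → ℂ} {z : ℂ} (hg : DifferentiableAt ℝ g z) (hh : DifferentiableAt ℝ h z) :
    wbar (fun x => g x + h x) z = wbar g z + wbar h z := by
  simp only [wbar, fderiv_fun_add hg hh]
  simp; ring

lemma wirt_congr {g h : ℂ → ℂ} {z : ℂ} (e : g =ᶠ[𝓝 z] h) : wirt g z = wirt h z := by
  simp only [wirt, e.fderiv_eq]

lemma wbar_congr {g h : ℂ → ℂ} {z : ℂ} (e : g =ᶠ[𝓝 z] h) : wbar g z = wbar h z := by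
  simp only [wbar, e.fderiv_eq]

lemma wirt_congr' {g h : ℂ → ℂ} {z : ℂ} (e : g =ᶠ[𝓝 z] h) : wirt g =ᶠ[𝓝 z] wirt h := by
  filter_upwards [e.eventually_nhds] with x hx using wirt_congr hx

lemma wirt_const (c z : ℂ) : wirt (fun _ => c) z = 0 := by simp [wirt]
lemma wbar_const (c z : ℂ) : wbar (fun _ => c) z = 0 := by simp [wbar]

lemma fderiv_holo {g : ℂ → ℂ} {z : ℂ} (hg : DifferentiableAt ℂ g z) (v : ℂ) :
    fderiv ℝ g z v = v * deriv g z := by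
  rw [hg.fderiv_restrictScalars ℝ]
  simp

lemma wirt_holo {g : ℂ → ℂ} {z : ℂ} (hg : DifferentiableAt ℂ g z) : wirt g z = deriv g z := by
  simp only [wirt, fderiv_holo hg]
  linear_combination (-(1/2) * deriv g z) * Complex.I_sq

lemma wbar_holo {g : ℂ → ℂ} {z : ℂ} (hg : DifferentiableAt ℂ g z) : wbar g z = 0 := by
  simp only [wbar, fderiv_holo hg]
  linear_combination ((1/2) * deriv g z) * Complex.I_sq

lemma fderiv_conj {g : ℂ → ℂ} {z : ℂ} (hg : DifferentiableAt ℝ g z) (v : ℂ) :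
    fderiv ℝ (fun x => conj (g x)) z v = conj (fderiv ℝ g z v) := by
  have := (Complex.conjCLE.toContinuousLinearMap.hasFDerivAt (x := g z)).comp z hg.hasFDerivAt
  have h2 : fderiv ℝ (fun x => conj (g x)) z = _ := this.fderiv
  rw [h2]; simp

lemma diff_conj {g : ℂ → ℂ} {z : ℂ} (hg : DifferentiableAt ℝ g z) :
    DifferentiableAt ℝ (fun x => conj (g x)) z :=
  ((Complex.conjCLE.toContinuousLinearMap.hasFDerivAt (x := g z)).comp z
    hg.hasFDerivAt).differentiableAt

lemma wirt_conj {g : ℂ → ℂ} {z : ℂ} (hg : DifferentiableAt ℝ g z) :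
    wirt (fun x => conj (g x)) z = conj (wbar g z) := by
  simp only [wirt, wbar, fderiv_conj hg]
  simp [Complex.conj_ofNat, sub_eq_add_neg]

lemma wbar_conj {g : ℂ → ℂ} {z : ℂ} (hg : DifferentiableAt ℝ g z) :
    wbar (fun x => conj (g x)) z = conj (wirt g z) := by
  simp only [wirt, wbar, fderiv_conj hg]
  simp [Complex.conj_ofNat]

lemma AnalyticAt.rdiff {g : ℂ → ℂ} {z : ℂ} (hg : AnalyticAt ℂ g z) : DifferentiableAt ℝ g z :=
  hg.differentiableAt.restrictScalars ℝ

lemma wirt_conj_holo {g : ℂ → ℂ} {z : ℂ} (hg : DifferentiableAt ℂ g z) :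
    wirt (fun x => conj (g x)) z = 0 := by
  rw [wirt_conj (hg.restrictScalars ℝ), wbar_holo hg, map_zero]

lemma wbar_conj_holo {g : ℂ → ℂ} {z : ℂ} (hg : DifferentiableAt ℂ g z) :
    wbar (fun x => conj (g x)) z = conj (deriv g z) := by
  rw [wbar_conj (hg.restrictScalars ℝ), wirt_holo hg]

lemma holo_of_wirt {g : ℂ → ℂ} {z : ℂ} (hg : DifferentiableAt ℝ g z) (h : wirt g z = 0) :
    DifferentiableAt ℂ (fun x => conj (g x)) z := by
  rw [differentiableAt_complex_iff_differentiableAt_real]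
  refine ⟨diff_conj hg, ?_⟩
  rw [fderiv_conj hg, fderiv_conj hg]
  have h2 : fderiv ℝ g z 1 = Complex.I * fderiv ℝ g z Complex.I := by
    simp only [wirt] at h
    linear_combination 2 * h
  rw [h2]
  simp only [map_mul, Complex.conj_I, smul_eq_mul]
  linear_combination (conj (fderiv ℝ g z Complex.I)) * Complex.I_sq

lemma wirt_contDiff {g : ℂ → ℂ} {z : ℂ} {n : ℕ} (hg : ContDiffAt ℝ (n + 1 : ℕ) g z) :
    ContDiffAt ℝ n (wirt g) z := by
  have h1 : ContDiffAt ℝ n (fderiv ℝ g) z := hg.fderiv_right (by norm_cast)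
  unfold wirt
  have h2 : ∀ v : ℂ, ContDiffAt ℝ n (fun x => fderiv ℝ g x v) z :=
    fun v => h1.clm_apply contDiffAt_const
  exact contDiffAt_const.mul ((h2 1).sub (contDiffAt_const.mul (h2 _)))

lemma fderiv_ofReal {v : ℂ → ℝ} {z : ℂ} (hv : DifferentiableAt ℝ v z) (c : ℂ) :
    fderiv ℝ (fun x => (v x : ℂ)) z c = (fderiv ℝ v z c : ℂ) := by
  have := (Complex.ofRealCLM.hasFDerivAt (x := v z)).comp z hv.hasFDerivAt
  have h2 : fderiv ℝ (fun x => (v x : ℂ)) z = _ := this.fderiv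
  rw [h2]; simp

lemma lapl_eq {v : ℂ → ℝ} {z : ℂ} (hv : ContDiffAt ℝ 2 v z) :
    lapl v z = (4 * wbar (wirt (fun x => (v x : ℂ))) z).re := by
  have h1 : ContDiffAt ℝ 1 (fderiv ℝ v) z := hv.fderiv_right (by norm_num)
  have h2 : ∀ c : ℂ, DifferentiableAt ℝ (fun x => fderiv ℝ v x c) z :=
    fun c => ((h1.clm_apply contDiffAt_const).differentiableAt (by norm_num))
  have e : wirt (fun x => (v x : ℂ)) =ᶠ[𝓝 z] fun x =>
      (1/2 : ℂ) * ((fderiv ℝ v x 1 : ℝ) : ℂ) + (-(1/2) * Complex.I) * ((fderiv ℝ v x Complex.I : ℝ) : ℂ) := by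
    filter_upwards [hv.eventually (by norm_num)] with x hx
    have := hx.differentiableAt (by norm_num)
    simp only [wirt, fderiv_ofReal this]; ring
  have h3 : ∀ c : ℂ, DifferentiableAt ℝ (fun x => ((fderiv ℝ v x c : ℝ) : ℂ)) z :=
    fun c => Complex.ofRealCLM.differentiableAt.comp z (h2 c)
  rw [wbar_congr e, wbar_add ((differentiableAt_const _).fun_mul (h3 1))
    ((differentiableAt_const _).fun_mul (h3 Complex.I)), wbar_mul (differentiableAt_const _) (h3 _),
    wbar_mul (differentiableAt_const _) (h3 _), wbar_const, wbar_const]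
  simp only [wbar, fderiv_ofReal (h2 _), lapl]
  simp
  ring

open Metric Set Filter Topology ComplexConjugate

/-- sesquilinear combination -/
noncomputable def sesq (c11 c12 c21 c22 : ℂ) (a1 a2 b1 b2 : ℂ → ℂ) (x : ℂ) : ℂ :=
  (c11 * (a1 x * conj (b1 x)) + c12 * (a2 x * conj (b1 x))) +
  (c21 * (a1 x * conj (b2 x)) + c22 * (a2 x * conj (b2 x)))

lemma rdiff_term (c : ℂ) {a b : ℂ → ℂ} {z : ℂ} (ha : AnalyticAt ℂ a z) (hb : AnalyticAt ℂ b z) :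
    DifferentiableAt ℝ (fun x => c * (a x * conj (b x))) z :=
  (differentiableAt_const _).fun_mul (ha.rdiff.fun_mul (diff_conj hb.rdiff))

lemma wirt_term (c : ℂ) {a b : ℂ → ℂ} {z : ℂ} (ha : AnalyticAt ℂ a z) (hb : AnalyticAt ℂ b z) :
    wirt (fun x => c * (a x * conj (b x))) z = c * (deriv a z * conj (b z)) := by
  rw [wirt_mul (differentiableAt_const _) (ha.rdiff.fun_mul (diff_conj hb.rdiff)),
    wirt_mul ha.rdiff (diff_conj hb.rdiff), wirt_const, wirt_holo ha.differentiableAt,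
    wirt_conj_holo hb.differentiableAt]
  ring

lemma wbar_term (c : ℂ) {a b : ℂ → ℂ} {z : ℂ} (ha : AnalyticAt ℂ a z) (hb : AnalyticAt ℂ b z) :
    wbar (fun x => c * (a x * conj (b x))) z = c * (a z * conj (deriv b z)) := by
  rw [wbar_mul (differentiableAt_const _) (ha.rdiff.fun_mul (diff_conj hb.rdiff)),
    wbar_mul ha.rdiff (diff_conj hb.rdiff), wbar_const, wbar_holo ha.differentiableAt,
    wbar_conj_holo hb.differentiableAt]
  ring

section
variable {c11 c12 c21 c22 : ℂ} {a1 a2 b1 b2 : ℂ → ℂ} {z : ℂ}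

lemma sesq_rdiff (ha1 : AnalyticAt ℂ a1 z) (ha2 : AnalyticAt ℂ a2 z)
    (hb1 : AnalyticAt ℂ b1 z) (hb2 : AnalyticAt ℂ b2 z) :
    DifferentiableAt ℝ (sesq c11 c12 c21 c22 a1 a2 b1 b2) z :=
  ((rdiff_term _ ha1 hb1).fun_add (rdiff_term _ ha2 hb1)).fun_add
    ((rdiff_term _ ha1 hb2).fun_add (rdiff_term _ ha2 hb2))

lemma sesq_wirt (ha1 : AnalyticAt ℂ a1 z) (ha2 : AnalyticAt ℂ a2 z)
    (hb1 : AnalyticAt ℂ b1 z) (hb2 : AnalyticAt ℂ b2 z) :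
    wirt (sesq c11 c12 c21 c22 a1 a2 b1 b2) z =
      sesq c11 c12 c21 c22 (deriv a1) (deriv a2) b1 b2 z := by
  unfold sesq
  rw [wirt_add ((rdiff_term _ ha1 hb1).fun_add (rdiff_term _ ha2 hb1))
    ((rdiff_term _ ha1 hb2).fun_add (rdiff_term _ ha2 hb2)),
    wirt_add (rdiff_term _ ha1 hb1) (rdiff_term _ ha2 hb1),
    wirt_add (rdiff_term _ ha1 hb2) (rdiff_term _ ha2 hb2),
    wirt_term _ ha1 hb1, wirt_term _ ha1 hb2, wirt_term _ ha2 hb1, wirt_term _ ha2 hb2]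

lemma sesq_wbar (ha1 : AnalyticAt ℂ a1 z) (ha2 : AnalyticAt ℂ a2 z)
    (hb1 : AnalyticAt ℂ b1 z) (hb2 : AnalyticAt ℂ b2 z) :
    wbar (sesq c11 c12 c21 c22 a1 a2 b1 b2) z =
      sesq c11 c12 c21 c22 a1 a2 (deriv b1) (deriv b2) z := by
  unfold sesq
  rw [wbar_add ((rdiff_term _ ha1 hb1).fun_add (rdiff_term _ ha2 hb1))
    ((rdiff_term _ ha1 hb2).fun_add (rdiff_term _ ha2 hb2)),
    wbar_add (rdiff_term _ ha1 hb1) (rdiff_term _ ha2 hb1),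
    wbar_add (rdiff_term _ ha1 hb2) (rdiff_term _ ha2 hb2),
    wbar_term _ ha1 hb1, wbar_term _ ha1 hb2, wbar_term _ ha2 hb1, wbar_term _ ha2 hb2]
end

/-- `v = -2 log w` relation on the level of Wirtinger derivatives. -/
lemma wirt_log {v w : ℂ → ℝ} {z : ℂ} (hw : DifferentiableAt ℝ w z) (hpos : w z ≠ 0)
    (e : v =ᶠ[𝓝 z] fun x => -2 * Real.log (w x)) :
    wirt (fun x => (v x : ℂ)) z * (w z : ℂ) = -2 * wirt (fun x => (w x : ℂ)) z := by
  have h1 : HasFDerivAt v ((-2 : ℝ) • ((w z)⁻¹ • fderiv ℝ w z)) z :=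
    ((hw.hasFDerivAt.log hpos).const_mul (-2)).congr_of_eventuallyEq e
  have h0 : (w z : ℂ) ≠ 0 := by exact_mod_cast hpos
  simp only [wirt, fderiv_ofReal h1.differentiableAt, fderiv_ofReal hw, h1.fderiv]
  simp only [FunLike.coe_smul, Pi.smul_apply, smul_eq_mul, Complex.ofReal_mul, Complex.ofReal_inv,
    Complex.ofReal_neg, Complex.ofReal_ofNat]
  field_simp
  ring

lemma lap_log {y1 y2 : ℂ → ℂ} {z : ℂ} (h1 : AnalyticAt ℂ y1 z) (h2 : AnalyticAt ℂ y2 z)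
    {c11 c12 c21 c22 : ℂ} {w v : ℂ → ℝ}
    (hw : ∀ᶠ x in 𝓝 z, (w x : ℂ) = sesq c11 c12 c21 c22 y1 y2 y1 y2 x) (hpos : 0 < w z)
    (hv : v =ᶠ[𝓝 z] fun x => -2 * Real.log (w x)) :
    (∀ n : ℕ, ContDiffAt ℝ n v z) ∧
    lapl v z = (-8 * ((c11 * c22 - c12 * c21) * (wron y1 y2 z * conj (wron y1 y2 z)) / (w z) ^ 2)).re := by
  have cw : ∀ n : ℕ, ContDiffAt ℝ n w z := by
    intro n
    have e : w =ᶠ[𝓝 z] fun x => (sesq c11 c12 c21 c22 y1 y2 y1 y2 x).re := by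
      filter_upwards [hw] with x hx
      rw [← hx, Complex.ofReal_re]
    refine ContDiffAt.congr_of_eventuallyEq ?_ e
    have d1 : ContDiffAt ℝ n y1 z := h1.contDiffAt.restrict_scalars ℝ
    have d2 : ContDiffAt ℝ n y2 z := h2.contDiffAt.restrict_scalars ℝ
    have d3 : ContDiffAt ℝ n (fun x => conj (y1 x)) z :=
      Complex.conjCLE.contDiff.contDiffAt.comp z d1
    have d4 : ContDiffAt ℝ n (fun x => conj (y2 x)) z :=
      Complex.conjCLE.contDiff.contDiffAt.comp z d2
    refine Complex.reCLM.contDiff.contDiffAt.comp z (?_ : ContDiffAt ℝ n (sesq c11 c12 c21 c22 y1 y2 y1 y2) z)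
    unfold sesq
    fun_prop
  have cv : ∀ n : ℕ, ContDiffAt ℝ n v z := by
    intro n
    exact ((contDiffAt_const).mul ((cw n).log hpos.ne')).congr_of_eventuallyEq hv
  refine ⟨cv, ?_⟩
  rw [lapl_eq (cv 2)]
  have h0 : (w z : ℂ) ≠ 0 := by exact_mod_cast hpos.ne'
  have ew : (fun x => (w x : ℂ)) =ᶠ[𝓝 z] sesq c11 c12 c21 c22 y1 y2 y1 y2 := hw
  have e1 : (fun x => wirt (fun x => (v x : ℂ)) x * (w x : ℂ)) =ᶠ[𝓝 z]
      fun x => (-2) * wirt (fun x => (w x : ℂ)) x := by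
    filter_upwards [hv.eventually_nhds, ((cw 1).eventually (by norm_num)),
      (cw 1).continuousAt.eventually (lt_mem_nhds hpos)] with x a b c
    exact wirt_log (b.differentiableAt (by norm_num)) (ne_of_gt c) a
  have e2 : wirt (fun x => (w x : ℂ)) =ᶠ[𝓝 z] sesq c11 c12 c21 c22 (deriv y1) (deriv y2) y1 y2 := by
    filter_upwards [ew.eventually_nhds, h1.eventually_analyticAt, h2.eventually_analyticAt] with x a b c
    rw [wirt_congr a, sesq_wirt b c b c]
  have dv : DifferentiableAt ℝ (wirt (fun x => (v x : ℂ))) z := by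
    have : ContDiffAt ℝ (1 + 1 : ℕ) (fun x => (v x : ℂ)) z :=
      Complex.ofRealCLM.contDiff.contDiffAt.comp z (cv 2)
    exact (wirt_contDiff this).differentiableAt (by norm_num)
  have dw : DifferentiableAt ℝ (fun x => (w x : ℂ)) z :=
    (sesq_rdiff h1 h2 h1 h2).congr_of_eventuallyEq ew
  have dP : DifferentiableAt ℝ (sesq c11 c12 c21 c22 (deriv y1) (deriv y2) y1 y2) z :=
    sesq_rdiff h1.deriv h2.deriv h1 h2
  have e3 : (fun x => wirt (fun x => (v x : ℂ)) x * (w x : ℂ)) =ᶠ[𝓝 z]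
      fun x => (-2) * sesq c11 c12 c21 c22 (deriv y1) (deriv y2) y1 y2 x := by
    filter_upwards [e1, e2] with x a b
    rw [a, b]
  have e4 := wbar_congr e3
  rw [wbar_mul dv dw, wbar_mul (differentiableAt_const _) dP, wbar_const, wbar_congr ew,
    sesq_wbar h1 h2 h1 h2, sesq_wbar h1.deriv h2.deriv h1 h2] at e4
  have e5 := e3.eq_of_nhds
  have e6 := ew.eq_of_nhds
  congr 1
  have e7 : wbar (wirt (fun x => (v x : ℂ))) z * (w z) ^ 2 = -2 * ((c11 * c22 - c12 * c21) * (wron y1 y2 z * conj (wron y1 y2 z))) := by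
    generalize wbar (wirt (fun x => (v x : ℂ))) z = X at *
    generalize wirt (fun x => (v x : ℂ)) z = Y at *
    simp only [wron, map_sub, map_mul]
    simp only [sesq] at e4 e5 e6
    generalize (w z : ℂ) = W at *
    linear_combination W * e4 - (c11 * (y1 z * conj (deriv y1 z)) + c12 * (y2 z * conj (deriv y1 z)) +
      (c21 * (y1 z * conj (deriv y2 z)) + c22 * (y2 z * conj (deriv y2 z)))) * e5 - 2 * (c11 * (deriv y1 z * conj (deriv y1 z)) + c12 * (deriv y2 z * conj (deriv y1 z)) +
      (c21 * (deriv y1 z * conj (deriv y2 z)) + c22 * (deriv y2 z * conj (deriv y2 z)))) * e6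
  field_simp
  linear_combination 4 * e7

open Metric Set Filter Topology ComplexConjugate

lemma q_an {q : ℂ → ℂ} {S : Set ℂ} (H : LocData q S) {p : ℂ} (hp : p ∉ S) : AnalyticAt ℂ q p := by
  obtain ⟨k, h, hh, hq, h3⟩ := H.loc p
  obtain ⟨_, hk, h4⟩ := h3.resolve_right fun h => hp h.1
  subst hk
  have a : AnalyticAt ℂ (fun z => h (z - p)) p :=
    AnalyticAt.fun_comp (g := h) (f := fun z => z - p) (by simpa using hh) (by fun_prop)
  refine a.congr ?_
  have t : Tendsto (fun w => w - p) (𝓝 p) (𝓝 0) := by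
    have : ContinuousAt (fun w => w - p) p := by fun_prop
    simpa [ContinuousAt] using this
  filter_upwards [t.eventually hq] with w hw
  by_cases hwp : w = p
  · subst hwp; simp [h4]
  · have := hw (sub_ne_zero.2 hwp)
    simp at this
    exact this.symm

lemma compl_nonempty {q : ℂ → ℂ} {S : Set ℂ} (H : LocData q S) : ∃ z, z ∉ S :=
  (H.isol 0).exists

lemma lemI {S : Set ℂ} (hS : IsClosed S) {y1 y2 D1 D2 : ℂ → ℂ} {c : ℂ} (hc : c ≠ 0)
    (h1 : ∀ z ∉ S, AnalyticAt ℂ y1 z) (h2 : ∀ z ∉ S, AnalyticAt ℂ y2 z)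
    (hw : ∀ z ∉ S, wron y1 y2 z = c)
    (d1 : ∀ z ∉ S, AnalyticAt ℂ D1 z) (d2 : ∀ z ∉ S, AnalyticAt ℂ D2 z)
    (e : ∀ z ∉ S, D1 z * conj (y1 z) + D2 z * conj (y2 z) = 0) :
    ∀ z ∉ S, D1 z = 0 ∧ D2 z = 0 := by
  intro z hz
  have ev : sesq 1 0 0 1 D1 D2 y1 y2 =ᶠ[𝓝 z] fun _ => 0 := by
    filter_upwards [hS.isOpen_compl.mem_nhds hz] with x hx
    simp only [sesq]
    linear_combination e x hx
  have e1 := wbar_congr ev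
  rw [sesq_wbar (d1 z hz) (d2 z hz) (h1 z hz) (h2 z hz), wbar_const] at e1
  have e0 := e z hz
  have ew : conj (wron y1 y2 z) ≠ 0 := by rw [hw z hz]; simpa using hc
  simp only [wron, map_sub, map_mul] at ew
  simp only [sesq] at e1
  constructor
  · refine (mul_eq_zero.1 (?_ : D1 z * _ = 0)).resolve_right ew
    linear_combination conj (deriv y2 z) * e0 - conj (y2 z) * e1
  · refine (mul_eq_zero.1 (?_ : D2 z * _ = 0)).resolve_right ew
    linear_combination conj (y1 z) * e1 - conj (deriv y1 z) * e0

lemma lin_indep {S : Set ℂ} (hS : IsClosed S) (hne : ∃ z, z ∉ S) {y1 y2 : ℂ → ℂ} {c : ℂ} (hc : c ≠ 0)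
    (h1 : ∀ z ∉ S, AnalyticAt ℂ y1 z) (h2 : ∀ z ∉ S, AnalyticAt ℂ y2 z)
    (hw : ∀ z ∉ S, wron y1 y2 z = c) {a b : ℂ}
    (e : ∀ z ∉ S, a * y1 z + b * y2 z = 0) : a = 0 ∧ b = 0 := by
  obtain ⟨z, hz⟩ := hne
  have := lemI hS hc h1 h2 hw (D1 := fun _ => conj a) (D2 := fun _ => conj b)
    (fun z _ => analyticAt_const) (fun z _ => analyticAt_const)
    (fun z hz => by rw [← map_mul, ← map_mul, ← map_add, e z hz, map_zero]) z hz
  simpa using this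

/-- uniqueness of coefficients of a sesquilinear form -/
lemma sesq_zero {S : Set ℂ} (hS : IsClosed S) (hne : ∃ z, z ∉ S) {y1 y2 : ℂ → ℂ} {c : ℂ} (hc : c ≠ 0)
    (h1 : ∀ z ∉ S, AnalyticAt ℂ y1 z) (h2 : ∀ z ∉ S, AnalyticAt ℂ y2 z)
    (hw : ∀ z ∉ S, wron y1 y2 z = c) {c11 c12 c21 c22 : ℂ}
    (e : ∀ z ∉ S, sesq c11 c12 c21 c22 y1 y2 y1 y2 z = 0) :
    (c11 = 0 ∧ c12 = 0) ∧ (c21 = 0 ∧ c22 = 0) := by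
  have := lemI hS hc h1 h2 hw (D1 := fun z => c11 * y1 z + c12 * y2 z)
    (D2 := fun z => c21 * y1 z + c22 * y2 z)
    (fun z hz => (analyticAt_const.mul (h1 z hz)).add (analyticAt_const.mul (h2 z hz)))
    (fun z hz => (analyticAt_const.mul (h1 z hz)).add (analyticAt_const.mul (h2 z hz)))
    (fun z hz => by rw [← e z hz]; simp only [sesq]; ring)
  exact ⟨lin_indep hS hne hc h1 h2 hw fun z hz => (this z hz).1,
    lin_indep hS hne hc h1 h2 hw fun z hz => (this z hz).2⟩

lemma form_of_u {q : ℂ → ℂ} {S : Set ℂ} (H : LocData q S) {w : ℂ → ℝ}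
    (cw : ∀ z ∉ S, ContDiffAt ℝ 2 w z)
    (hw : ∀ z ∉ S, wirt (wirt (fun x => (w x : ℂ))) z = q z * w z)
    {y1 y2 : ℂ → ℂ} {c : ℂ} (hc : c ≠ 0)
    (h1 : ∀ z, IsSol q S y1 z) (h2 : ∀ z, IsSol q S y2 z) (hW : ∀ z ∉ S, wron y1 y2 z = c) :
    ∃ c11 c12 c21 c22, ∀ z ∉ S, (w z : ℂ) = sesq c11 c12 c21 c22 y1 y2 y1 y2 z := by
  have hS := H.closed
  have a1 : ∀ z ∉ S, AnalyticAt ℂ y1 z := fun z hz => ((h1 z).2 hz).1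
  have a2 : ∀ z ∉ S, AnalyticAt ℂ y2 z := fun z hz => ((h2 z).2 hz).1
  set W : ℂ → ℂ := fun x => (w x : ℂ) with hWdef
  have cW : ∀ z ∉ S, ContDiffAt ℝ (1 + 1 : ℕ) W z := fun z hz =>
      Complex.ofRealCLM.contDiff.contDiffAt.comp z (cw z hz)
  have dW : ∀ z ∉ S, DifferentiableAt ℝ W z := fun z hz => (cW z hz).differentiableAt (by norm_num)
  have dWz : ∀ z ∉ S, DifferentiableAt ℝ (wirt W) z := fun z hz =>
    (wirt_contDiff (cW z hz)).differentiableAt (by norm_num)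
  -- generic construction
  have key : ∀ y : ℂ → ℂ, (∀ z, IsSol q S y z) → ∀ z ∉ S,
      AnalyticAt ℂ (fun x => conj (W x * deriv y x + (-1) * (wirt W x * y x))) z := by
    intro y hy
    have : DifferentiableOn ℂ (fun x => conj (W x * deriv y x + (-1) * (wirt W x * y x))) Sᶜ := by
      intro z hz
      obtain ⟨b1, b2⟩ := (hy z).2 hz
      refine (holo_of_wirt (g := fun x => W x * deriv y x + (-1) * (wirt W x * y x)) ?_ ?_).differentiableWithinAt
      · exact ((dW z hz).fun_mul b1.deriv.rdiff).fun_add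
          ((differentiableAt_const _).fun_mul ((dWz z hz).fun_mul b1.rdiff))
      · rw [wirt_add ((dW z hz).fun_mul b1.deriv.rdiff)
          ((differentiableAt_const _).fun_mul ((dWz z hz).fun_mul b1.rdiff)),
          wirt_mul (dW z hz) b1.deriv.rdiff,
          wirt_mul (differentiableAt_const _) ((dWz z hz).fun_mul b1.rdiff),
          wirt_mul (dWz z hz) b1.rdiff, wirt_const, wirt_holo b1.differentiableAt,
          wirt_holo b1.deriv.differentiableAt, b2, hw z hz]
        simp only [hWdef]
        ring
    intro z hz
    exact this.analyticAt (hS.isOpen_compl.mem_nhds hz)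
  -- coefficients
  set B1 : ℂ → ℂ := fun x => (conj c)⁻¹ * conj (W x * deriv y2 x + (-1) * (wirt W x * y2 x)) with hB1
  set B2 : ℂ → ℂ := fun x => (-(conj c)⁻¹) * conj (W x * deriv y1 x + (-1) * (wirt W x * y1 x)) with hB2
  have bA1 : ∀ z ∉ S, AnalyticAt ℂ B1 z := fun z hz => analyticAt_const.mul (key y2 h2 z hz)
  have bA2 : ∀ z ∉ S, AnalyticAt ℂ B2 z := fun z hz => analyticAt_const.mul (key y1 h1 z hz)
  have hc' : conj c ≠ 0 := by simpa using hc
  have eW : ∀ z ∉ S, W z = sesq 1 0 0 1 B1 B2 y1 y2 z := by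
    intro z hz
    have e1 : conj (W z) = W z := by simp [hWdef]
    have e2 := congrArg conj (hW z hz)
    simp only [wron, map_sub, map_mul] at e2
    simp only [sesq, hB1, hB2, map_add, map_mul, e1]
    field_simp
    simp only [map_neg, map_one]
    linear_combination -W z * e2
  have evW : ∀ z ∉ S, W =ᶠ[𝓝 z] sesq 1 0 0 1 B1 B2 y1 y2 := fun z hz => by
    filter_upwards [hS.isOpen_compl.mem_nhds hz] with x hx using eW x hx
  have ewz : ∀ z ∉ S, wirt W z = sesq 1 0 0 1 (deriv B1) (deriv B2) y1 y2 z := fun z hz => by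
    rw [wirt_congr (evW z hz), sesq_wirt (bA1 z hz) (bA2 z hz) (a1 z hz) (a2 z hz)]
  have ewzz : ∀ z ∉ S, wirt (wirt W) z = sesq 1 0 0 1 (deriv (deriv B1)) (deriv (deriv B2)) y1 y2 z := fun z hz => by
    have : wirt W =ᶠ[𝓝 z] sesq 1 0 0 1 (deriv B1) (deriv B2) y1 y2 := by
      filter_upwards [hS.isOpen_compl.mem_nhds hz] with x hx using ewz x hx
    rw [wirt_congr this, sesq_wirt (bA1 z hz).deriv (bA2 z hz).deriv (a1 z hz) (a2 z hz)]
  have hD := lemI hS hc a1 a2 hW (D1 := fun z => deriv (deriv B1) z - q z * B1 z)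
    (D2 := fun z => deriv (deriv B2) z - q z * B2 z)
    (fun z hz => (bA1 z hz).deriv.deriv.sub ((q_an H hz).mul (bA1 z hz)))
    (fun z hz => (bA2 z hz).deriv.deriv.sub ((q_an H hz).mul (bA2 z hz)))
    (fun z hz => by
      have e1 := ewzz z hz
      have e2 := eW z hz
      have e3 := hw z hz
      have e4 : (w z : ℂ) = W z := rfl
      rw [e1, e4, e2] at e3
      simp only [sesq] at e3
      linear_combination e3)
  obtain ⟨c11, c12, hB1e⟩ := glob_expand H hc h1 h2 hW (y := B1)
    (fun z hz => ⟨bA1 z hz, sub_eq_zero.1 (hD z hz).1⟩)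
  obtain ⟨c21, c22, hB2e⟩ := glob_expand H hc h1 h2 hW (y := B2)
    (fun z hz => ⟨bA2 z hz, sub_eq_zero.1 (hD z hz).2⟩)
  refine ⟨c11, c12, c21, c22, fun z hz => ?_⟩
  have e4 : (w z : ℂ) = W z := rfl
  rw [e4, eW z hz]
  simp only [sesq]
  rw [hB1e z hz, hB2e z hz]
  ring

open Metric Set Filter Topology ComplexConjugate

lemma wron_comb {y1 y2 : ℂ → ℂ} {z : ℂ} (h1 : AnalyticAt ℂ y1 z) (h2 : AnalyticAt ℂ y2 z)
    (a b c d : ℂ) : wron (fun x => a * y1 x + b * y2 x) (fun x => c * y1 x + d * y2 x) z =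
      (a * d - b * c) * wron y1 y2 z := by
  have e : ∀ a b : ℂ, deriv (fun x => a * y1 x + b * y2 x) z = a * deriv y1 z + b * deriv y2 z := by
    intro a b
    exact ((h1.differentiableAt.hasDerivAt.const_mul a).add
        (h2.differentiableAt.hasDerivAt.const_mul b)).deriv
  simp only [wron, e]
  ring

structure Frame (q : ℂ → ℂ) (S : Set ℂ) (u : ℂ → ℝ) (y1 y2 : ℂ → ℂ) : Prop where
  sol1 : ∀ z, IsSol q S y1 z
  sol2 : ∀ z, IsSol q S y2 z
  wr : ∃ c : ℂ, ‖c‖ = 1 ∧ ∀ z ∉ S, wron y1 y2 z = c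
  form : ∀ z ∉ S, √8 * Real.exp (-u z / 2) = ‖y1 z‖ ^ 2 + ‖y2 z‖ ^ 2

lemma frame_of_u {q : ℂ → ℂ} {S : Set ℂ} (H : LocData q S) {u : ℂ → ℝ}
    (hu : ∀ z ∉ S, (∀ n : ℕ, ContDiffAt ℝ n u z) ∧ lapl u z + Real.exp (u z) = 0)
    (hq : ∀ z ∉ S, uPot u z = q z) : ∃ y1 y2, Frame q S u y1 y2 := by
  have hS := H.closed
  obtain ⟨z0, hz0⟩ := compl_nonempty H
  obtain ⟨y1, y2, c, hc, h1, h2, hW⟩ := glob_sols H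
  have a1 : ∀ z ∉ S, AnalyticAt ℂ y1 z := fun z hz => ((h1 z).2 hz).1
  have a2 : ∀ z ∉ S, AnalyticAt ℂ y2 z := fun z hz => ((h2 z).2 hz).1
  set w : ℂ → ℝ := fun z => Real.exp (-u z / 2) with hwdef
  have wpos : ∀ z, 0 < w z := fun z => Real.exp_pos _
  have cw : ∀ z ∉ S, ContDiffAt ℝ 2 w z := fun z hz => by
    have := (hu z hz).1 2
    exact (this.neg.div_const 2).exp
  have ulog : u = fun x => -2 * Real.log (w x) := by
    funext x; simp only [hwdef, Real.log_exp]; ring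
  have hw : ∀ z ∉ S, wirt (wirt (fun x => (w x : ℂ))) z = q z * w z := by
    intro z hz
    rw [← hq z hz]
    have e1 : (fun x => wirt (fun x => (u x : ℂ)) x * (w x : ℂ)) =ᶠ[𝓝 z]
        fun x => (-2) * wirt (fun x => (w x : ℂ)) x := by
      filter_upwards [hS.isOpen_compl.mem_nhds hz] with x hx
      exact wirt_log ((cw x hx).differentiableAt (by norm_num)) (wpos x).ne' (by rw [← ulog])
    have cW : ContDiffAt ℝ (1 + 1 : ℕ) (fun x => (w x : ℂ)) z :=
      Complex.ofRealCLM.contDiff.contDiffAt.comp z (cw z hz)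
    have cU : ContDiffAt ℝ (1 + 1 : ℕ) (fun x => (u x : ℂ)) z :=
      Complex.ofRealCLM.contDiff.contDiffAt.comp z ((hu z hz).1 2)
    have e2 := wirt_congr e1
    have e3 := e1.eq_of_nhds
    rw [wirt_mul ((wirt_contDiff cU).differentiableAt (by norm_num))
      (cW.differentiableAt (by norm_num)), wirt_mul (differentiableAt_const _)
      ((wirt_contDiff cW).differentiableAt (by norm_num)), wirt_const] at e2
    simp only [uPot]
    linear_combination (1/2) * e2 - (1/4) * wirt (fun x => (u x : ℂ)) z * e3
  obtain ⟨c11, c12, c21, c22, hform⟩ := form_of_u H cw hw hc h1 h2 hW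
  -- hermitian
  have herm := sesq_zero hS ⟨z0, hz0⟩ hc a1 a2 hW (c11 := c11 - conj c11) (c12 := c12 - conj c21)
    (c21 := c21 - conj c12) (c22 := c22 - conj c22) (by
      intro z hz
      have e1 := hform z hz
      have e2 := congrArg conj e1
      rw [Complex.conj_ofReal, e1] at e2
      simp only [sesq, map_add, map_mul, Complex.conj_conj] at e2 ⊢
      linear_combination e2)
  obtain ⟨⟨k1, -⟩, k2, k3⟩ := herm
  obtain ⟨α, rfl⟩ := Complex.conj_eq_iff_real.1 (sub_eq_zero.1 k1).symm
  obtain ⟨γ, rfl⟩ := Complex.conj_eq_iff_real.1 (sub_eq_zero.1 k3).symm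
  obtain rfl := sub_eq_zero.1 k2
  set d : ℝ := α * γ - ‖c12‖ ^ 2 with hd
  have hdc : (d : ℂ) = α * γ - c12 * conj c12 := by
    rw [Complex.mul_conj']; push_cast [hd]; rfl
  -- determinant
  have hdet : 8 * d * ‖c‖ ^ 2 = 1 := by
    have e1 := (lap_log (a1 z0 hz0) (a2 z0 hz0) (w := w) (v := u)
      (by filter_upwards [hS.isOpen_compl.mem_nhds hz0] with x hx using hform x hx) (wpos z0)
      (by rw [← ulog])).2
    have e2 := (hu z0 hz0).2
    rw [← hdc, hW z0 hz0, Complex.mul_conj'] at e1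
    have e3 : lapl u z0 = -8 * (d * ‖c‖ ^ 2 / w z0 ^ 2) := by
      rw [e1, ← Complex.ofReal_re (-8 * (d * ‖c‖ ^ 2 / w z0 ^ 2))]
      push_cast; rfl
    have e4 : Real.exp (u z0) * w z0 ^ 2 = 1 := by
      rw [hwdef, ← Real.exp_nat_mul, ← Real.exp_add]
      simp
      ring
    have := (wpos z0).ne'
    rw [e3] at e2
    field_simp at e2
    linear_combination e4 - e2
  have hcn : 0 < ‖c‖ ^ 2 := by positivity
  have hdpos : 0 < d := by
    by_contra hneg
    push Not at hneg
    nlinarith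
  -- completing the square
  have sq : ∀ z ∉ S, α * w z = ‖α * y1 z + c12 * y2 z‖ ^ 2 + d * ‖y2 z‖ ^ 2 := by
    intro z hz
    have e1 := hform z hz
    apply Complex.ofReal_injective
    push_cast
    rw [← Complex.mul_conj', ← Complex.mul_conj', hdc, e1]
    simp only [sesq, map_add, map_mul, Complex.conj_ofReal]
    ring
  have hα : 0 < α := by
    have e := sq z0 hz0
    have h0 : 0 ≤ α * w z0 := by rw [e]; positivity
    have h1 : 0 ≤ α := nonneg_of_mul_nonneg_left h0 (wpos z0)
    rcases h1.lt_or_eq with h | h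
    · exact h
    · rw [← h] at hd
      nlinarith [sq_nonneg ‖c12‖]
  have h8 : (0:ℝ) < √8 := by positivity
  obtain ⟨s1, hs1, hs1e⟩ : ∃ s : ℝ, 0 < s ∧ s ^ 2 = √8 / α :=
    ⟨√(√8 / α), by positivity, Real.sq_sqrt (by positivity)⟩
  obtain ⟨s2, hs2, hs2e⟩ : ∃ s : ℝ, 0 < s ∧ s ^ 2 = √8 * d / α :=
    ⟨√(√8 * d / α), by positivity, Real.sq_sqrt (by positivity)⟩
  refine ⟨fun z => (s1 * α) * y1 z + (s1 * c12) * y2 z, fun z => 0 * y1 z + s2 * y2 z, ?_⟩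
  refine ⟨fun z => (h1 z).comb _ _ (h2 z), fun z => (h1 z).comb _ _ (h2 z),
    ⟨(s1 * α * s2 - s1 * c12 * 0) * c, ?_, ?_⟩, ?_⟩
  · have : ‖((s1 * α * s2 - s1 * c12 * 0) * c : ℂ)‖ = s1 * α * s2 * ‖c‖ := by
      rw [mul_zero, sub_zero, norm_mul, norm_mul, norm_mul, Complex.norm_of_nonneg hs1.le,
        Complex.norm_of_nonneg hs2.le, Complex.norm_of_nonneg hα.le]
    rw [this]
    have h3 : (s1 * α * s2 * ‖c‖) ^ 2 = 1 := by
      have : (s1 * α * s2 * ‖c‖) ^ 2 = s1 ^ 2 * α ^ 2 * s2 ^ 2 * ‖c‖ ^ 2 := by ring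
      rw [this, hs1e, hs2e]
      have h88 : √8 * √8 = 8 := Real.mul_self_sqrt (by norm_num)
      field_simp
      linear_combination d * ‖c‖ ^ 2 * h88 + hdet
    nlinarith [(by positivity : 0 < s1 * α * s2 * ‖c‖)]
  · intro z hz
    rw [wron_comb (a1 z hz) (a2 z hz), hW z hz]
  · intro z hz
    have e1 : (s1 * α : ℂ) * y1 z + (s1 * c12) * y2 z = s1 * (α * y1 z + c12 * y2 z) := by ring
    simp only [e1, zero_mul, zero_add, norm_mul, Complex.norm_of_nonneg hs1.le,
        Complex.norm_of_nonneg hs2.le, mul_pow, hs1e, hs2e]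
    have := sq z hz
    simp only [hwdef] at this ⊢
    generalize Real.exp (-u z / 2) = X at this ⊢
    field_simp
    linear_combination this

open Metric Set Filter Topology ComplexConjugate

lemma aff_deriv (y : ℂ → ℂ) (s l z : ℂ) (h : DifferentiableAt ℂ y (s * z + l)) :
    deriv (fun x => y (s * x + l)) z = s * deriv y (s * z + l) := by
  have h1 : HasDerivAt (fun x : ℂ => s * x + l) s z := by
    simpa using ((hasDerivAt_id z).const_mul s).add_const l
  have := h.hasDerivAt.comp z h1
  rw [mul_comm]
  exact this.deriv

lemma aff_an {y : ℂ → ℂ} {s l z : ℂ} (h : AnalyticAt ℂ y (s * z + l)) :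
    AnalyticAt ℂ (fun x => y (s * x + l)) z := by
  have h1 : AnalyticAt ℂ (fun x : ℂ => s * x + l) z :=
    (analyticAt_const.mul analyticAt_id).add analyticAt_const
  exact AnalyticAt.comp (g := y) (f := fun x : ℂ => s * x + l) h h1

lemma aff_sol {q : ℂ → ℂ} {S : Set ℂ} {y : ℂ → ℂ} (h : ∀ z, IsSol q S y z)
    (s l : ℂ) (hs : s * s = 1) (hS : ∀ z, s * z + l ∈ S ↔ z ∈ S) (hq : ∀ z, q (s * z + l) = q z)
    (z : ℂ) (hz : z ∉ S) : AnalyticAt ℂ (fun x => y (s * x + l)) z ∧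
      deriv (deriv (fun x => y (s * x + l))) z = q z * y (s * z + l) := by
  have hz' : s * z + l ∉ S := fun h => hz ((hS z).1 h)
  obtain ⟨h1, h2⟩ := (h _).2 hz'
  refine ⟨aff_an h1, ?_⟩
  have e : deriv (fun x => y (s * x + l)) =ᶠ[𝓝 z] fun x => s * deriv y (s * x + l) := by
    have c : Tendsto (fun x : ℂ => s * x + l) (𝓝 z) (𝓝 (s * z + l)) :=
      Continuous.tendsto (by fun_prop) z
    filter_upwards [c.eventually h1.eventually_analyticAt] with x hx
    exact aff_deriv _ _ _ _ hx.differentiableAt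
  rw [e.deriv_eq, deriv_const_mul _ (aff_an h1.deriv).differentiableAt,
    aff_deriv _ _ _ _ h1.deriv.differentiableAt, ← mul_assoc, hs, one_mul, h2, hq]

lemma frame_indep {q : ℂ → ℂ} {S : Set ℂ} (H : LocData q S) {u : ℂ → ℝ} {y1 y2 : ℂ → ℂ}
    (F : Frame q S u y1 y2) {a b c d : ℂ} (e : ∀ z, a * y1 z + b * y2 z = c * y1 z + d * y2 z) :
    a = c ∧ b = d := by
  obtain ⟨w, hw, hW⟩ := F.wr
  have hw0 : w ≠ 0 := by rintro rfl; simp at hw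
  have := lin_indep H.closed (compl_nonempty H) hw0 (fun z hz => ((F.sol1 z).2 hz).1)
    (fun z hz => ((F.sol2 z).2 hz).1) hW (a := a - c) (b := b - d)
    (fun z _ => by linear_combination e z)
  exact ⟨sub_eq_zero.1 this.1, sub_eq_zero.1 this.2⟩

lemma frame_aff {q : ℂ → ℂ} {S : Set ℂ} (H : LocData q S) {u : ℂ → ℝ} {y1 y2 : ℂ → ℂ}
    (F : Frame q S u y1 y2)
    (s l : ℂ) (hs : s * s = 1) (hS : ∀ z, s * z + l ∈ S ↔ z ∈ S) (hq : ∀ z, q (s * z + l) = q z) :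
    ∃ a b c d : ℂ, a * d - b * c = s ∧ (∀ z, y1 (s * z + l) = a * y1 z + b * y2 z) ∧
      ∀ z, y2 (s * z + l) = c * y1 z + d * y2 z := by
  obtain ⟨w, hw, hW⟩ := F.wr
  have hw0 : w ≠ 0 := by rintro rfl; simp at hw
  obtain ⟨a, b, hab⟩ := glob_expand H hw0 F.sol1 F.sol2 hW (aff_sol F.sol1 s l hs hS hq)
  obtain ⟨c, d, hcd⟩ := glob_expand H hw0 F.sol1 F.sol2 hW (aff_sol F.sol2 s l hs hS hq)
  refine ⟨a, b, c, d, ?_, ?_, ?_⟩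
  · obtain ⟨z, hz⟩ := compl_nonempty H
    have hz' : s * z + l ∉ S := fun h => hz ((hS z).1 h)
    have a1 := ((F.sol1 z).2 hz).1
    have a2 := ((F.sol2 z).2 hz).1
    have b1 := ((F.sol1 _).2 hz').1
    have b2 := ((F.sol2 _).2 hz').1
    have e := wron_comb a1 a2 a b c d
    have n := H.closed.isOpen_compl.mem_nhds hz
    have e1 : (fun x => y1 (s * x + l)) =ᶠ[𝓝 z] fun x => a * y1 x + b * y2 x := by
      filter_upwards [n] with x hx using hab x hx
    have e2 : (fun x => y2 (s * x + l)) =ᶠ[𝓝 z] fun x => c * y1 x + d * y2 x := by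
      filter_upwards [n] with x hx using hcd x hx
    have e3 := hW _ hz'
    rw [hW z hz] at e
    simp only [wron, ← e1.deriv_eq, ← e2.deriv_eq, ← hab z hz, ← hcd z hz] at e
    rw [aff_deriv _ _ _ _ b1.differentiableAt, aff_deriv _ _ _ _ b2.differentiableAt] at e
    simp only [wron] at e3
    apply mul_right_cancel₀ hw0
    rw [← e]
    linear_combination s * e3
  · intro z
    by_cases hz : z ∈ S
    · rw [((F.sol1 z).1 hz).1, ((F.sol2 z).1 hz).1, ((F.sol1 _).1 ((hS z).2 hz)).1]; simp
    · exact hab z hz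
  · intro z
    by_cases hz : z ∈ S
    · rw [((F.sol1 z).1 hz).1, ((F.sol2 z).1 hz).1, ((F.sol2 _).1 ((hS z).2 hz)).1]; simp
    · exact hcd z hz

/-- `l` is a common period. -/
structure Per (q : ℂ → ℂ) (S : Set ℂ) (u : ℂ → ℝ) (l : ℂ) : Prop where
  hS : ∀ z, z + l ∈ S ↔ z ∈ S
  hq : ∀ z, q (z + l) = q z
  hu : ∀ z, u (z + l) = u z

lemma frame_per {q : ℂ → ℂ} {S : Set ℂ} (H : LocData q S) {u : ℂ → ℝ} {y1 y2 : ℂ → ℂ}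
    (F : Frame q S u y1 y2) {l : ℂ} (P : Per q S u l) :
    ∃ a b : ℂ, a * conj a + b * conj b = 1 ∧ (∀ z, y1 (z + l) = a * y1 z + b * y2 z) ∧
      ∀ z, y2 (z + l) = - conj b * y1 z + conj a * y2 z := by
  obtain ⟨a, b, c, d, hdet, h1, h2⟩ := frame_aff H F 1 l (by norm_num)
    (by simpa using P.hS) (by simpa using P.hq)
  simp only [one_mul] at h1 h2
  obtain ⟨w, hw, hW⟩ := F.wr
  have hw0 : w ≠ 0 := by rintro rfl; simp at hw
  have key := sesq_zero H.closed (compl_nonempty H) hw0 (fun z hz => ((F.sol1 z).2 hz).1)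
    (fun z hz => ((F.sol2 z).2 hz).1) hW (c11 := a * conj a + c * conj c - 1)
    (c12 := b * conj a + d * conj c) (c21 := a * conj b + c * conj d)
    (c22 := b * conj b + d * conj d - 1) (by
      intro z hz
      have e1 := F.form z hz
      have e2 := F.form (z + l) (fun h => hz ((P.hS z).1 h))
      rw [P.hu, e1, h1, h2] at e2
      have e3 := congrArg (fun x : ℝ => (x : ℂ)) e2
      push_cast at e3
      simp only [← Complex.mul_conj', map_add, map_mul] at e3
      simp only [sesq]
      linear_combination -e3)
  obtain ⟨⟨k1, k2⟩, k3, k4⟩ := key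
  have hd : d = conj a := by
    linear_combination (-d) * k1 + c * k2 + conj a * hdet
  have hc : c = - conj b := by
    linear_combination (-c) * k4 + d * k3 - conj b * hdet
  subst hd
  subst hc
  refine ⟨a, b, by linear_combination hdet, h1, h2⟩

lemma frame_neg {q : ℂ → ℂ} {S : Set ℂ} (H : LocData q S) {u : ℂ → ℝ} {y1 y2 : ℂ → ℂ}
    (F : Frame q S u y1 y2) (hS : ∀ z, -z ∈ S ↔ z ∈ S) (hq : ∀ z, q (-z) = q z) :
    ∃ n p r : ℂ, n * n + p * r = 1 ∧ (∀ z, y1 (-z) = n * y1 z + p * y2 z) ∧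
      ∀ z, y2 (-z) = r * y1 z - n * y2 z := by
  obtain ⟨n, p, r, n', hdet, h1, h2⟩ := frame_aff H F (-1) 0 (by norm_num)
    (by simpa using hS) (by simpa using hq)
  simp only [neg_one_mul, add_zero] at h1 h2
  have k1 := frame_indep H F (a := n * n + p * r) (b := n * p + p * n') (c := 1) (d := 0) (by
    intro z
    have e := h1 (-z)
    rw [neg_neg, h1 z, h2 z] at e
    linear_combination -e)
  have k2 := frame_indep H F (a := r * n + n' * r) (b := r * p + n' * n') (c := 0) (d := 1) (by
    intro z
    have e := h2 (-z)
    rw [neg_neg, h1 z, h2 z] at e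
    linear_combination -e)
  have : n' = -n := by
    have : (n + n') ^ 2 = 0 := by
      linear_combination k1.1 + k2.2 + 2 * hdet
    have := pow_eq_zero_iff (two_ne_zero) |>.1 this
    linear_combination this
  subst this
  exact ⟨n, p, r, k1.1, h1, fun z => by rw [h2]; ring⟩

lemma frame_rot {q : ℂ → ℂ} {S : Set ℂ} (H : LocData q S) {u : ℂ → ℝ} {y1 y2 : ℂ → ℂ}
    (F : Frame q S u y1 y2) {α β : ℂ} (h : α * conj α + β * conj β = 1) :
    Frame q S u (fun z => α * y1 z + β * y2 z) (fun z => -conj β * y1 z + conj α * y2 z) := by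
  obtain ⟨w, hw, hW⟩ := F.wr
  refine ⟨fun z => (F.sol1 z).comb _ _ (F.sol2 z), fun z => (F.sol1 z).comb _ _ (F.sol2 z),
    ⟨w, hw, ?_⟩, ?_⟩
  · intro z hz
    rw [wron_comb ((F.sol1 z).2 hz).1 ((F.sol2 z).2 hz).1, hW z hz]
    linear_combination w * h
  · intro z hz
    rw [F.form z hz]
    apply Complex.ofReal_injective
    push_cast
    simp only [← Complex.mul_conj', map_add, map_mul, map_neg, Complex.conj_conj]
    linear_combination (-(y1 z * conj (y1 z)) - (y2 z * conj (y2 z))) * h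

lemma normalize2 {α β : ℂ} (h : α ≠ 0 ∨ β ≠ 0) : ∃ t : ℝ,
    (t * α) * conj (t * α) + (t * β) * conj (t * β) = (1:ℂ) := by
  have hp : 0 < ‖α‖ ^ 2 + ‖β‖ ^ 2 := by
    rcases h with h | h
    · have := norm_pos_iff.2 h; positivity
    · have := norm_pos_iff.2 h; positivity
  refine ⟨1 / √(‖α‖ ^ 2 + ‖β‖ ^ 2), ?_⟩
  have e : (1 / √(‖α‖ ^ 2 + ‖β‖ ^ 2)) ^ 2 * (‖α‖ ^ 2 + ‖β‖ ^ 2) = 1 := by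
    rw [div_pow, Real.sq_sqrt hp.le]
    field_simp
  generalize 1 / √(‖α‖ ^ 2 + ‖β‖ ^ 2) = t at e
  have e3 := congrArg (fun x : ℝ => (x : ℂ)) e
  push_cast at e3
  simp only [← Complex.mul_conj'] at e3
  simp only [map_mul, Complex.conj_ofReal]
  linear_combination e3

/-- Diagonalisation of one monodromy. -/
lemma frame_diag {q : ℂ → ℂ} {S : Set ℂ} (H : LocData q S) {u : ℂ → ℝ} {y1 y2 : ℂ → ℂ}
    (F : Frame q S u y1 y2) {l : ℂ} (P : Per q S u l) :
    ∃ α β lam : ℂ, α * conj α + β * conj β = 1 ∧ lam * conj lam = 1 ∧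
      (∀ z, α * y1 (z + l) + β * y2 (z + l) = lam * (α * y1 z + β * y2 z)) ∧
      ∀ z, -conj β * y1 (z + l) + conj α * y2 (z + l) = conj lam * (-conj β * y1 z + conj α * y2 z) := by
  obtain ⟨a, b, hab, h1, h2⟩ := frame_per H F P
  have main : ∃ α β lam : ℂ, (α ≠ 0 ∨ β ≠ 0) ∧ α * a - β * conj b = lam * α ∧
      α * b + β * conj a = lam * β := by
    by_cases hb : b = 0
    · exact ⟨1, 0, a, Or.inl one_ne_zero, by simp, by simp [hb]⟩
    · obtain ⟨s, hs⟩ := IsAlgClosed.exists_pow_nat_eq ((a + conj a) ^ 2 - 4) (n := 2) (by norm_num)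
      refine ⟨conj b, a - (a + conj a + s) / 2, (a + conj a + s) / 2, Or.inl (by simpa using hb),
        by ring, ?_⟩
      linear_combination hab + hs / 4
  obtain ⟨α0, β0, lam, hne, e1, e2⟩ := main
  obtain ⟨t, ht⟩ := normalize2 hne
  have e1' : (t * α0) * a - (t * β0) * conj b = lam * (t * α0) := by linear_combination t * e1
  have e2' : (t * α0) * b + (t * β0) * conj a = lam * (t * β0) := by linear_combination t * e2
  generalize (t * α0 : ℂ) = α at ht e1' e2'
  generalize (t * β0 : ℂ) = β at ht e1' e2'
  obtain ⟨a', b', hab', h1', h2'⟩ := frame_per H (frame_rot H F ht) P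
  have k1 : ∀ z, α * y1 (z + l) + β * y2 (z + l) = lam * (α * y1 z + β * y2 z) := by
    intro z
    rw [h1, h2]
    linear_combination y1 z * e1' + y2 z * e2'
  obtain ⟨r1, r2⟩ := frame_indep H (frame_rot H F ht) (a := lam) (b := 0) (c := a') (d := b') (by
    intro z
    have := h1' z
    rw [k1] at this
    linear_combination this)
  subst r1
  subst r2
  refine ⟨α, β, lam, ht, by simpa using hab', k1, fun z => ?_⟩
  have := h2' z
  rw [this]
  simp

lemma num_range (n p r : ℂ) : ∃ α β : ℂ, (α ≠ 0 ∨ β ≠ 0) ∧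
    n * (α * conj α) + p * (α * conj β) + r * (β * conj α) - n * (β * conj β) = 0 := by
  by_cases hn : n = 0
  · exact ⟨1, 0, Or.inl one_ne_zero, by simp [hn]⟩
  obtain ⟨P, hP⟩ : ∃ P, P = p / n := ⟨_, rfl⟩
  obtain ⟨R, hR⟩ : ∃ R, R = r / n := ⟨_, rfl⟩
  have hp : p = n * P := by rw [hP]; field_simp
  have hr : r = n * R := by rw [hR]; field_simp
  obtain ⟨e, he0, he⟩ : ∃ e : ℂ, e ≠ 0 ∧ (P * conj e + R * e).im = 0 := by
    by_cases h : (⟨P.re - R.re, P.im + R.im⟩ : ℂ) = 0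
    · refine ⟨1, one_ne_zero, ?_⟩
      have := congrArg Complex.im h
      simpa using this
    · refine ⟨_, h, ?_⟩
      simp [Complex.add_im, Complex.mul_im]
      ring
  set κ := (P * conj e + R * e).re with hκ
  have hκ' : P * conj e + R * e = κ := by
    apply Complex.ext <;> simp only [Complex.ofReal_re, Complex.ofReal_im, hκ, he]
  obtain ⟨x, hx⟩ : ∃ x : ℝ, x ^ 2 + κ * x - ‖e‖ ^ 2 = 0 := by
    refine ⟨(-κ + √(κ ^ 2 + 4 * ‖e‖ ^ 2)) / 2, ?_⟩
    have := Real.sq_sqrt (show 0 ≤ κ ^ 2 + 4 * ‖e‖ ^ 2 by positivity)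
    linear_combination this / 4
  refine ⟨x, e, Or.inr he0, ?_⟩
  have hx' := congrArg (fun x : ℝ => (x : ℂ)) hx
  push_cast at hx'
  rw [← Complex.mul_conj'] at hx'
  rw [hp, hr, Complex.conj_ofReal]
  linear_combination n * hx' + n * x * hκ'

/-- The good frame. -/
structure Good (q : ℂ → ℂ) (S : Set ℂ) (u : ℂ → ℝ) (τ : ℂ) (y1 y2 : ℂ → ℂ) : Prop where
  fr : Frame q S u y1 y2
  p1 : ∃ lam : ℂ, lam * conj lam = 1 ∧ (∀ z, y1 (z + 1) = lam * y1 z) ∧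
    ∀ z, y2 (z + 1) = conj lam * y2 z
  p2 : ∃ lam : ℂ, lam * conj lam = 1 ∧ (∀ z, y1 (z + τ) = lam * y1 z) ∧
    ∀ z, y2 (z + τ) = conj lam * y2 z
  inv : ∃ b : ℂ, b ≠ 0 ∧ (∀ z, y1 (-z) = b * y2 z) ∧ ∀ z, y2 (-z) = b⁻¹ * y1 z

lemma inv_of_n {q : ℂ → ℂ} {S : Set ℂ} (H : LocData q S) {u : ℂ → ℝ} {y1 y2 : ℂ → ℂ}
    {n p r : ℂ} (hn : n * n + p * r = 1) (h1 : ∀ z, y1 (-z) = n * y1 z + p * y2 z)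
    (h2 : ∀ z, y2 (-z) = r * y1 z - n * y2 z) (h0 : n = 0) :
    ∃ b : ℂ, b ≠ 0 ∧ (∀ z, y1 (-z) = b * y2 z) ∧ ∀ z, y2 (-z) = b⁻¹ * y1 z := by
  subst h0
  have hpr : p * r = 1 := by linear_combination hn
  have hp : p ≠ 0 := left_ne_zero_of_mul_eq_one hpr
  refine ⟨p, hp, fun z => by rw [h1]; ring, fun z => ?_⟩
  rw [h2, eq_inv_of_mul_eq_one_right hpr]; ring

lemma scal_of {q : ℂ → ℂ} {y1 y2 : ℂ → ℂ} {l lam : ℂ} (hl : lam * conj lam = 1) (hl2 : lam * lam = 1)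
    (h1 : ∀ z, y1 (z + l) = lam * y1 z) (h2 : ∀ z, y2 (z + l) = conj lam * y2 z) (a b : ℂ) (z : ℂ) :
    a * y1 (z + l) + b * y2 (z + l) = lam * (a * y1 z + b * y2 z) := by
  have : conj lam = lam := by linear_combination (-conj lam) * hl2 + lam * hl
  rw [h1, h2, this]; ring

/-- If one monodromy is diagonal and nonscalar. -/
lemma good_of_ne {q : ℂ → ℂ} {S : Set ℂ} (H : LocData q S) {u : ℂ → ℝ} {y1 y2 : ℂ → ℂ}
    (F : Frame q S u y1 y2) (hSn : ∀ z, -z ∈ S ↔ z ∈ S) (hqn : ∀ z, q (-z) = q z)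
    {l l' lam : ℂ} (P : Per q S u l') (hl : lam * conj lam = 1) (hl2 : lam * lam ≠ 1)
    (h1 : ∀ z, y1 (z + l) = lam * y1 z) (h2 : ∀ z, y2 (z + l) = conj lam * y2 z) :
    (∃ lam : ℂ, lam * conj lam = 1 ∧ (∀ z, y1 (z + l') = lam * y1 z) ∧
      ∀ z, y2 (z + l') = conj lam * y2 z) ∧
    (∃ b : ℂ, b ≠ 0 ∧ (∀ z, y1 (-z) = b * y2 z) ∧ ∀ z, y2 (-z) = b⁻¹ * y1 z) := by
  constructor
  · obtain ⟨a, b, hab, k1, k2⟩ := frame_per H F P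
    have e := (frame_indep H F (a := lam * a) (b := lam * b) (c := a * lam) (d := b * conj lam) (by
      intro z
      have e1 := h1 (z + l')
      have e2 := k1 (z + l)
      rw [add_right_comm, e1, k1, h1, h2] at e2
      linear_combination e2)).2
    have : b = 0 := by
      have : b * (lam * lam - 1) = 0 := by linear_combination lam * e + b * hl
      rcases mul_eq_zero.1 this with h | h
      · exact h
      · exact absurd (sub_eq_zero.1 h) hl2
    subst this
    refine ⟨a, by simpa using hab, fun z => by rw [k1]; ring, fun z => by rw [k2]; simp⟩
  · obtain ⟨n, p, r, hn, k1, k2⟩ := frame_neg H F hSn hqn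
    refine inv_of_n (u := u) H hn k1 k2 ?_
    have e := (frame_indep H F (a := n) (b := p) (c := n * lam * lam) (d := p * conj lam * lam) (by
      intro z
      have e1 := h1 (-(z + l))
      have e2 := k1 (z + l)
      rw [show -(z + l) + l = -z by ring, e2, k1, h1, h2] at e1
      linear_combination e1)).1
    have : n * (lam * lam - 1) = 0 := by linear_combination -e
    rcases mul_eq_zero.1 this with h | h
    · exact h
    · exact absurd (sub_eq_zero.1 h) hl2

lemma good_frame {q : ℂ → ℂ} {S : Set ℂ} (H : LocData q S) {u : ℂ → ℝ} {y1 y2 : ℂ → ℂ} {τ : ℂ}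
    (F : Frame q S u y1 y2) (hSn : ∀ z, -z ∈ S ↔ z ∈ S) (hqn : ∀ z, q (-z) = q z)
    (P1 : Per q S u 1) (P2 : Per q S u τ) : ∃ y1 y2, Good q S u τ y1 y2 := by
  obtain ⟨α, β, lam, hαβ, hl, k1, k2⟩ := frame_diag H F P1
  have F1 := frame_rot H F hαβ
  generalize eY1 : (fun z => α * y1 z + β * y2 z) = Y1 at F1
  generalize eY2 : (fun z => -conj β * y1 z + conj α * y2 z) = Y2 at F1
  replace k1 : ∀ z, Y1 (z + 1) = lam * Y1 z := by rw [← eY1]; exact k1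
  replace k2 : ∀ z, Y2 (z + 1) = conj lam * Y2 z := by rw [← eY2]; exact k2
  by_cases hl2 : lam * lam = 1
  swap
  · obtain ⟨r1, r2⟩ := good_of_ne H F1 hSn hqn P2 hl hl2 k1 k2
    exact ⟨Y1, Y2, F1, ⟨lam, hl, k1, k2⟩, r1, r2⟩
  have hcl : conj lam = lam := by linear_combination (-conj lam) * hl2 + lam * hl
  clear eY1 eY2
  obtain ⟨α', β', lam', hαβ', hl', k1', k2'⟩ := frame_diag H F1 P2
  have F2 := frame_rot H F1 hαβ'
  generalize eZ1 : (fun z => α' * Y1 z + β' * Y2 z) = Z1 at F2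
  generalize eZ2 : (fun z => -conj β' * Y1 z + conj α' * Y2 z) = Z2 at F2
  replace k1' : ∀ z, Z1 (z + τ) = lam' * Z1 z := by rw [← eZ1]; exact k1'
  replace k2' : ∀ z, Z2 (z + τ) = conj lam' * Z2 z := by rw [← eZ2]; exact k2'
  have j1 : ∀ z, Z1 (z + 1) = lam * Z1 z := by
    rw [← eZ1]; exact fun z => scal_of (q := q) hl hl2 k1 k2 _ _ z
  have j2 : ∀ z, Z2 (z + 1) = conj lam * Z2 z := by
    rw [← eZ2, hcl]; exact fun z => scal_of (q := q) hl hl2 k1 k2 _ _ z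
  by_cases hl2' : lam' * lam' = 1
  swap
  · obtain ⟨r1, r2⟩ := good_of_ne H F2 hSn hqn P1 hl' hl2' k1' k2'
    exact ⟨Z1, Z2, F2, r1, ⟨lam', hl', k1', k2'⟩, r2⟩
  have hcl' : conj lam' = lam' := by linear_combination (-conj lam') * hl2' + lam' * hl'
  clear eZ1 eZ2
  obtain ⟨n, p, r, hn, i1, i2⟩ := frame_neg H F2 hSn hqn
  obtain ⟨a0, b0, hne, e0⟩ := num_range n p r
  obtain ⟨t, ht⟩ := normalize2 hne
  have e1 : n * ((t * a0) * conj (t * a0)) + p * ((t * a0) * conj (t * b0))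
      + r * ((t * b0) * conj (t * a0)) - n * ((t * b0) * conj (t * b0)) = 0 := by
    simp only [map_mul, Complex.conj_ofReal]
    linear_combination t * t * e0
  generalize (t * a0 : ℂ) = a at ht e1
  generalize (t * b0 : ℂ) = b at ht e1
  have F3 := frame_rot H F2 ht
  obtain ⟨n', p', r', hn', i1', i2'⟩ := frame_neg H F3 hSn hqn
  have h0 : n' = 0 := by
    obtain ⟨g1, g2⟩ := frame_indep H F2 (a := a * n + b * r) (b := a * p - b * n)
      (c := n' * a - p' * conj b) (d := n' * b + p' * conj a) (by
        intro z
        have e2 := i1' z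
        simp only [i1 z, i2 z] at e2
        linear_combination e2)
    linear_combination e1 - conj a * g1 - conj b * g2 - n' * ht
  refine ⟨_, _, F3, ⟨lam, hl, ?_, ?_⟩, ⟨lam', hl', ?_, ?_⟩, ?_⟩
  · exact fun z => scal_of (q := q) hl hl2 j1 j2 _ _ z
  · rw [hcl]; exact fun z => scal_of (q := q) hl hl2 j1 j2 _ _ z
  · exact fun z => scal_of (q := q) hl' hl2' k1' k2' _ _ z
  · rw [hcl']; exact fun z => scal_of (q := q) hl' hl2' k1' k2' _ _ z
  · exact inv_of_n (u := u) (y1 := fun z => a * Z1 z + b * Z2 z)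
      (y2 := fun z => -conj b * Z1 z + conj a * Z2 z) H hn' i1' i2' h0

open Metric Set Filter Topology ComplexConjugate

lemma Frame.wron_ne {q : ℂ → ℂ} {S : Set ℂ} {v : ℂ → ℝ} {y1 y2 : ℂ → ℂ} (F : Frame q S v y1 y2)
    {z : ℂ} (hz : z ∉ S) : wron y1 y2 z ≠ 0 := by
  obtain ⟨c, hc, hW⟩ := F.wr
  rw [hW z hz]
  rintro rfl
  simp at hc

lemma dev_off {q : ℂ → ℂ} {S : Set ℂ} {v : ℂ → ℝ} {y1 y2 : ℂ → ℂ}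
    (F : Frame q S v y1 y2) {z : ℂ} (hz : z ∉ S) (ha : AnalyticAt ℂ (fun x => y2 x / y1 x) z) :
    Real.exp (v z) = 8 * ‖deriv (fun x => y2 x / y1 x) z‖ ^ 2 / (1 + ‖y2 z / y1 z‖ ^ 2) ^ 2 := by
  have a1 := ((F.sol1 z).2 hz).1
  have a2 := ((F.sol2 z).2 hz).1
  have hw0 := F.wron_ne hz
  obtain ⟨c, hc, hW⟩ := F.wr
  by_cases h0 : y1 z = 0
  · exfalso
    have hd : deriv y1 z ≠ 0 := by
      intro h; apply hw0; simp [wron, h, h0]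
    have hy2 : y2 z ≠ 0 := by
      intro h; apply hw0; simp [wron, h, h0]
    have e1 : ∀ᶠ x in 𝓝[≠] z, y1 x ≠ 0 := a1.differentiableAt.hasDerivAt.eventually_ne hd
    have t1 : Tendsto (fun x => (y2 x / y1 x) * y1 x) (𝓝[≠] z) (𝓝 ((y2 z / y1 z) * y1 z)) :=
      ((ha.continuousAt.mul a1.continuousAt).tendsto).mono_left nhdsWithin_le_nhds
    have t2 : Tendsto y2 (𝓝[≠] z) (𝓝 (y2 z)) :=
      a2.continuousAt.tendsto.mono_left nhdsWithin_le_nhds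
    have t3 : Tendsto y2 (𝓝[≠] z) (𝓝 ((y2 z / y1 z) * y1 z)) := by
      refine t1.congr' ?_
      filter_upwards [e1] with x hx
      field_simp
    have := tendsto_nhds_unique t2 t3
    rw [h0, mul_zero] at this
    exact hy2 this
  · have ed : deriv (fun x => y2 x / y1 x) z = c / y1 z ^ 2 := by
      have := (a2.differentiableAt.hasDerivAt.div a1.differentiableAt.hasDerivAt h0).deriv
      rw [← hW z hz]
      refine Eq.trans this ?_
      simp only [wron]
      ring
    rw [ed, norm_div, norm_div, hc, norm_pow]
    have hn : 0 < ‖y1 z‖ := norm_pos_iff.2 h0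
    have hf := F.form z hz
    have h8 : √8 ^ 2 = (8:ℝ) := Real.sq_sqrt (by norm_num)
    have he : Real.exp (v z) * Real.exp (-v z / 2) ^ 2 = 1 := by
      rw [← Real.exp_nat_mul, ← Real.exp_add]
      simp
      ring
    have e2 : Real.exp (v z) * (‖y1 z‖ ^ 2 + ‖y2 z‖ ^ 2) ^ 2 = 8 := by
      rw [← hf, mul_pow, h8]
      linear_combination 8 * he
    have e3 : (1 + (‖y2 z‖ / ‖y1 z‖) ^ 2) = (‖y1 z‖ ^ 2 + ‖y2 z‖ ^ 2) / ‖y1 z‖ ^ 2 := by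
      field_simp
    have e4 : 0 < ‖y1 z‖ ^ 2 + ‖y2 z‖ ^ 2 := by positivity
    rw [e3]
    field_simp
    linear_combination e2

lemma dev_of_frame {q : ℂ → ℂ} {S : Set ℂ} (H : LocData q S) {v : ℂ → ℝ} {y1 y2 : ℂ → ℂ}
    (F : Frame q S v y1 y2) (hv : ∀ p ∈ S, Tendsto v (𝓝[≠] p) atBot) :
    IsDevelopingMapOf v (fun z => y2 z / y1 z) := by
  have mer : ∀ y : ℂ → ℂ, (∀ z, IsSol q S y z) → ∀ z, MeromorphicAt y z := by
    intro y hy z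
    by_cases hz : z ∈ S
    · exact ((hy z).1 hz).2
    · exact ((hy z).2 hz).1.meromorphicAt
  refine ⟨fun z => (mer _ F.sol2 z).fun_div (mer _ F.sol1 z), fun z ha hd => ?_⟩
  by_cases hz : z ∈ S
  · exfalso
    have e1 : ∀ᶠ x in 𝓝[≠] z, Real.exp (v x) =
        8 * ‖deriv (fun x => y2 x / y1 x) x‖ ^ 2 / (1 + ‖y2 x / y1 x‖ ^ 2) ^ 2 := by
      filter_upwards [H.isol z, ha.eventually_analyticAt.filter_mono nhdsWithin_le_nhds] with x hx hx'
      exact dev_off F hx hx'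
    have t1 : Tendsto (fun x => Real.exp (v x)) (𝓝[≠] z) (𝓝 0) :=
      Real.tendsto_exp_atBot.comp (hv z hz)
    have t2 : ContinuousAt (fun x => 8 * ‖deriv (fun x => y2 x / y1 x) x‖ ^ 2 /
        (1 + ‖y2 x / y1 x‖ ^ 2) ^ 2) z := by
      refine ContinuousAt.div ?_ ?_ (by positivity)
      · exact continuousAt_const.mul (ha.deriv.continuousAt.norm.pow 2)
      · exact (continuousAt_const.add (ha.continuousAt.norm.pow 2)).pow 2
    have t3 := (t2.tendsto.mono_left (nhdsWithin_le_nhds (s := {z}ᶜ))).congr'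
      (e1.mono fun x hx => hx.symm)
    have := tendsto_nhds_unique t1 t3
    have hp : 0 < 8 * ‖deriv (fun x => y2 x / y1 x) z‖ ^ 2 / (1 + ‖y2 z / y1 z‖ ^ 2) ^ 2 := by
      have := norm_pos_iff.2 hd
      positivity
    linarith
  · rw [← dev_off F hz ha, Real.log_exp]

lemma sol_atBot {τ : ℂ} {m : Fin 4 → ℕ} {u : ℂ → ℝ}
    (h : ∀ k : Fin 4, 1 ≤ m k → ∀ l ∈ lat τ,
    ∃ C ε : ℝ, 0 < ε ∧ ∀ z : ℂ, z ≠ per τ (k : ℕ) / 2 + l →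
      dist z (per τ (k : ℕ) / 2 + l) < ε →
      |u z - 4 * (m k : ℝ) * Real.log (dist z (per τ (k : ℕ) / 2 + l))| ≤ C) :
    ∀ p ∈ singSet τ m, Tendsto u (𝓝[≠] p) atBot := by
  rintro p ⟨k, hk, l, hl, rfl⟩
  obtain ⟨C, ε, hε, hC⟩ := h k hk l hl
  generalize per τ (k : ℕ) / 2 + l = p at hC
  have t0 : Tendsto (fun z => dist z p) (𝓝[≠] p) (𝓝[≠] 0) := by
    rw [tendsto_nhdsWithin_iff]
    constructor
    · have : Tendsto (fun z => dist z p) (𝓝 p) (𝓝 (dist p p)) :=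
        Continuous.tendsto (by fun_prop) p
      rw [dist_self] at this
      exact this.mono_left nhdsWithin_le_nhds
    · filter_upwards [self_mem_nhdsWithin] with x hx
      exact dist_ne_zero.2 hx
  have t1 : Tendsto (fun z => C + 4 * (m k : ℝ) * Real.log (dist z p)) (𝓝[≠] p) atBot := by
    apply tendsto_atBot_add_const_left
    apply Tendsto.const_mul_atBot
    · have : (0:ℝ) < m k := by exact_mod_cast hk
      positivity
    · exact Real.tendsto_log_nhdsNE_zero.comp t0
  refine tendsto_atBot_mono' _ ?_ t1
  filter_upwards [self_mem_nhdsWithin, mem_nhdsWithin_of_mem_nhds (ball_mem_nhds p hε)] with z hz hz'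
  have := abs_le.1 (hC z hz hz')
  linarith [this.2]

lemma arg_exp {lam : ℂ} (h : lam * conj lam = 1) : ∃ θ : ℝ,
    conj lam / lam = Complex.exp (2 * Complex.I * (θ : ℂ)) := by
  have hn : ‖lam‖ = 1 := by
    rw [Complex.mul_conj'] at h
    have : ‖lam‖ ^ 2 = 1 := by exact_mod_cast h
    nlinarith [norm_nonneg lam]
  obtain ⟨θ, hθ⟩ := (Complex.norm_eq_one_iff lam).1 hn
  refine ⟨-θ, ?_⟩
  rw [← hθ, ← Complex.exp_conj, ← Complex.exp_sub]
  congr 1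
  simp
  ring

open Metric Set Filter Topology ComplexConjugate

lemma frame_scale {q : ℂ → ℂ} {S : Set ℂ} {u : ℂ → ℝ} {y1 y2 : ℂ → ℂ}
    (F : Frame q S u y1 y2) (t : ℝ) (ht : t ≠ 0) {v : ℂ → ℝ}
    (hv : ∀ z, z ∉ S → v z = -2 * Real.log ((‖(t:ℂ)⁻¹ * y1 z‖ ^ 2 + ‖(t:ℂ) * y2 z‖ ^ 2) / √8)) :
    Frame q S v (fun z => (t:ℂ)⁻¹ * y1 z) (fun z => (t:ℂ) * y2 z) := by
  have ht' : (t:ℂ) ≠ 0 := by exact_mod_cast ht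
  have e1 : (fun z => (t:ℂ)⁻¹ * y1 z) = fun z => (t:ℂ)⁻¹ * y1 z + 0 * y2 z := by funext z; ring
  have e2 : (fun z => (t:ℂ) * y2 z) = fun z => 0 * y1 z + (t:ℂ) * y2 z := by funext z; ring
  obtain ⟨c, hc, hW⟩ := F.wr
  have hwr : ∀ z ∉ S, wron (fun z => (t:ℂ)⁻¹ * y1 z) (fun z => (t:ℂ) * y2 z) z = c := by
    intro z hz
    rw [e1, e2, wron_comb ((F.sol1 z).2 hz).1 ((F.sol2 z).2 hz).1, hW z hz]
    field_simp
    ring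
  refine ⟨?_, ?_, ⟨c, hc, hwr⟩, ?_⟩
  · rw [e1]; exact fun z => (F.sol1 z).comb _ _ (F.sol2 z)
  · rw [e2]; exact fun z => (F.sol1 z).comb _ _ (F.sol2 z)
  · intro z hz
    have hpos : 0 < ‖(t:ℂ)⁻¹ * y1 z‖ ^ 2 + ‖(t:ℂ) * y2 z‖ ^ 2 := by
      have hw := F.wron_ne hz
      by_cases h1 : y1 z = 0
      · have h2 : y2 z ≠ 0 := by
          intro h; apply hw; simp [wron, h, h1]
        have := norm_pos_iff.2 (mul_ne_zero ht' h2)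
        positivity
      · have := norm_pos_iff.2 (mul_ne_zero (inv_ne_zero ht') h1)
        positivity
    rw [hv z hz]
    have h8 : (0:ℝ) < √8 := by positivity
    rw [show ∀ x : ℝ, - (-2 * x) / 2 = x by intro x; ring, Real.exp_log (by positivity)]
    field_simp

lemma frame_curv {q : ℂ → ℂ} {S : Set ℂ} (H : LocData q S) {v : ℂ → ℝ} {y1 y2 : ℂ → ℂ}
    (F : Frame q S v y1 y2) {z : ℂ} (hz : z ∉ S) :
    (∀ n : ℕ, ContDiffAt ℝ n v z) ∧ lapl v z + Real.exp (v z) = 0 := by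
  obtain ⟨c, hc, hW⟩ := F.wr
  have h8 : (0:ℝ) < √8 := by positivity
  have h88 : √8 * √8 = 8 := Real.mul_self_sqrt (by norm_num)
  have key := lap_log (c11 := ((1 / √8 : ℝ) : ℂ)) (c12 := 0) (c21 := 0) (c22 := ((1 / √8 : ℝ) : ℂ))
    ((F.sol1 z).2 hz).1 ((F.sol2 z).2 hz).1 (w := fun x => Real.exp (-v x / 2)) (v := v)
    (by
      filter_upwards [H.closed.isOpen_compl.mem_nhds hz] with x hx
      have := F.form x hx
      have e : Real.exp (-v x / 2) = (1 / √8) * (‖y1 x‖ ^ 2 + ‖y2 x‖ ^ 2) := by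
        rw [← this]; field_simp
      rw [e]
      simp only [sesq, Complex.mul_conj']
      push_cast
      ring) (Real.exp_pos _)
    (Eventually.of_forall fun x => by simp only [Real.log_exp]; ring)
  refine ⟨key.1, ?_⟩
  rw [key.2, hW z hz, Complex.mul_conj', hc]
  have he : Real.exp (v z) * Real.exp (-v z / 2) ^ 2 = 1 := by
    rw [← Real.exp_nat_mul, ← Real.exp_add]
    simp
    ring
  have hp := Real.exp_pos (-v z / 2)
  generalize Real.exp (-v z / 2) = w at he hp
  have e : (-8 * ((((1 / √8 : ℝ) : ℂ) * ((1 / √8 : ℝ) : ℂ) - 0 * 0) * (((1:ℝ) : ℂ) ^ 2) / (w : ℂ) ^ 2))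
      = ((-8 * ((1 / √8) * (1 / √8) / w ^ 2) : ℝ) : ℂ) := by
    push_cast; ring
  rw [e, Complex.ofReal_re]
  have e2 : (1 / √8) * (1 / √8) = 1 / 8 := by rw [div_mul_div_comm, h88]; norm_num
  rw [e2]
  field_simp
  linear_combination he

lemma close_asym {τ : ℂ} (hτ : 0 < τ.im) {m : Fin 4 → ℕ} {u v : ℂ → ℝ} {B : ℝ}
    (hB : ∀ z ∉ singSet τ m, |v z - u z| ≤ B)
    (h : ∀ k : Fin 4, 1 ≤ m k → ∀ l ∈ lat τ,
    ∃ C ε : ℝ, 0 < ε ∧ ∀ z : ℂ, z ≠ per τ (k : ℕ) / 2 + l →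
      dist z (per τ (k : ℕ) / 2 + l) < ε →
      |u z - 4 * (m k : ℝ) * Real.log (dist z (per τ (k : ℕ) / 2 + l))| ≤ C) :
    ∀ k : Fin 4, 1 ≤ m k → ∀ l ∈ lat τ,
    ∃ C ε : ℝ, 0 < ε ∧ ∀ z : ℂ, z ≠ per τ (k : ℕ) / 2 + l →
      dist z (per τ (k : ℕ) / 2 + l) < ε →
      |v z - 4 * (m k : ℝ) * Real.log (dist z (per τ (k : ℕ) / 2 + l))| ≤ C := by
  intro k hk l hl
  obtain ⟨C, ε, hε, hC⟩ := h k hk l hl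
  have hi := sing_isol hτ m (per τ (k : ℕ) / 2 + l)
  generalize per τ (k : ℕ) / 2 + l = p at hC hi
  obtain ⟨δ, hδ, hi⟩ := Metric.mem_nhdsWithin_iff.1 hi
  refine ⟨B + C, min ε δ, lt_min hε hδ, fun z hz hd => ?_⟩
  have h1 := hC z hz (hd.trans_le (min_le_left _ _))
  have h2 := hB z (hi ⟨hd.trans_le (min_le_right _ _), hz⟩)
  calc _ = |(v z - u z) + (u z - 4 * (m k : ℝ) * Real.log (dist z p))| := by ring_nf
    _ ≤ _ := (abs_add_le _ _).trans (add_le_add h2 h1)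

lemma close_uv {q : ℂ → ℂ} {S : Set ℂ} {u v : ℂ → ℝ} {y1 y2 : ℂ → ℂ}
    (F : Frame q S u y1 y2) (t : ℝ) (ht : 0 < t)
    (G : Frame q S v (fun z => (t:ℂ)⁻¹ * y1 z) (fun z => (t:ℂ) * y2 z)) :
    ∀ z ∉ S, |v z - u z| ≤ 2 * |Real.log (t ^ 2 + (t ^ 2)⁻¹)| := by
  intro z hz
  have e1 := F.form z hz
  have e2 := G.form z hz
  have h8 : (0:ℝ) < √8 := by positivity
  simp only [norm_mul, norm_inv, Complex.norm_of_nonneg ht.le, mul_pow, inv_pow] at e2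
  set K := t ^ 2 + (t ^ 2)⁻¹ with hK
  have ht2 : 0 < t ^ 2 := by positivity
  have hti : 0 < (t ^ 2)⁻¹ := by positivity
  have hm : t ^ 2 * (t ^ 2)⁻¹ = 1 := mul_inv_cancel₀ ht2.ne'
  generalize t ^ 2 = s at *
  generalize s⁻¹ = s' at *
  have hKp : 0 < K := by positivity
  have n1 := sq_nonneg ‖y1 z‖
  have n2 := sq_nonneg ‖y2 z‖
  generalize ‖y1 z‖ ^ 2 = A at *
  generalize ‖y2 z‖ ^ 2 = B at *
  have i1 : √8 * Real.exp (-v z / 2) ≤ √8 * (K * Real.exp (-u z / 2)) := by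
    have : √8 * (K * Real.exp (-u z / 2)) = K * (A + B) := by rw [← e1]; ring
    rw [this, e2, hK]
    nlinarith [mul_nonneg ht2.le n1, mul_nonneg hti.le n2]
  have i2 : √8 * Real.exp (-u z / 2) ≤ √8 * (K * Real.exp (-v z / 2)) := by
    have : √8 * (K * Real.exp (-v z / 2)) = K * (s' * A + s * B) := by rw [← e2]; ring
    rw [this, e1, hK]
    have : (s + s') * (s' * A + s * B) = A + B + s' * s' * A + s * s * B := by
      linear_combination (A + B) * hm
    rw [this]
    have := mul_nonneg (mul_nonneg hti.le hti.le) n1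
    have := mul_nonneg (mul_nonneg ht2.le ht2.le) n2
    linarith
  have j1 := le_of_mul_le_mul_left i1 h8
  have j2 := le_of_mul_le_mul_left i2 h8
  rw [← Real.exp_log hKp, ← Real.exp_add, Real.exp_le_exp] at j1 j2
  have := le_abs_self (Real.log K)
  rw [abs_le]
  constructor <;> linarith

/-- **Theorem (Statement 11).** If the potential associated with a solution `u` of the
curvature equation is the Heun potential `Σ m_k(m_k+1)℘(z - ω_k/2) - E` (all residues
vanish), then `u` is contained in an even family of solutions. -/
theorem statement11 (τ : ℂ) (hτ : 0 < τ.im) (m : Fin 4 → ℕ) (hm : 1 ≤ ∑ k, m k)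
    (u : ℂ → ℝ) (hu : IsCurvatureSolution τ m u) (E : ℂ)
    (hq : ∀ z ∉ singSet τ m,
      uPot u z =
        (∑ j : Fin 4, (m j : ℂ) * ((m j : ℂ) + 1) * wp τ (z - per τ (j : ℕ) / 2)) - E) :
    ∃ f : ℂ → ℂ, IsDevelopingMapOf u f ∧ IsTypeII τ f ∧ FamilyHasEven τ m f := by
  classical
  obtain ⟨hu1, hu2, hu3, hu4⟩ := hu
  have H := heun_loc hτ m E
  obtain ⟨x1, x2, F0⟩ := frame_of_u H hu3 hq
  obtain ⟨y1, y2, F, ⟨l1, hl1, p1, p1'⟩, ⟨l2, hl2, p2, p2'⟩, b, hb, n1, n2⟩ :=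
    good_frame (τ := τ) H F0 sing_neg (heunQ_even hτ m E)
      ⟨sing_add (lat_one τ), heunQ_per hτ m E (lat_one τ), hu1⟩
      ⟨sing_add (lat_tau τ), heunQ_per hτ m E (lat_tau τ), hu2⟩
  refine ⟨fun z => y2 z / y1 z, dev_of_frame H F (sol_atBot hu4), ?_, ?_⟩
  · obtain ⟨θ1, h1⟩ := arg_exp hl1
    obtain ⟨θ2, h2⟩ := arg_exp hl2
    refine ⟨θ1, θ2, fun z => ?_, fun z => ?_⟩
    · simp only [p1, p1', ← h1]; rw [mul_div_mul_comm]
    · simp only [p2, p2', ← h2]; rw [mul_div_mul_comm]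
  · have hbn : 0 < ‖b‖ := norm_pos_iff.2 hb
    have norm1 : ∀ {l : ℂ}, l * conj l = 1 → ‖l‖ = 1 := by
      intro l h
      rw [Complex.mul_conj'] at h
      have : ‖l‖ ^ 2 = 1 := by exact_mod_cast h
      nlinarith [norm_nonneg l]
    obtain ⟨t, ht, htb⟩ : ∃ t : ℝ, 0 < t ∧ t ^ 2 = ‖b‖ :=
      ⟨√‖b‖, by positivity, Real.sq_sqrt hbn.le⟩
    set v : ℂ → ℝ := fun z => if z ∈ singSet τ m then 0 else
      -2 * Real.log ((‖(t:ℂ)⁻¹ * y1 z‖ ^ 2 + ‖(t:ℂ) * y2 z‖ ^ 2) / √8) with hv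
    have G := frame_scale F t ht.ne' (v := v) (fun z hz => if_neg hz)
    have as := close_asym hτ (close_uv F t ht G) hu4
    refine ⟨Real.log ‖b‖, v, ⟨?_, ?_, fun z hz => frame_curv H G hz, as⟩, ?_, ?_⟩
    · intro z
      simp only [hv, p1, p1', sing_add (lat_one τ), norm_mul, RCLike.norm_conj, norm1 hl1, one_mul]
    · intro z
      simp only [hv, p2, p2', sing_add (lat_tau τ), norm_mul, RCLike.norm_conj, norm1 hl2, one_mul]
    · have D := dev_of_frame H G (sol_atBot as)
      convert D using 2 with z
      rw [Real.exp_log hbn, ← htb]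
      have : (t:ℂ) ≠ 0 := by exact_mod_cast ht.ne'
      push_cast
      rw [mul_div_mul_comm, div_inv_eq_mul]
      ring
    · intro z
      simp only [hv, sing_neg, n1, n2, norm_mul, norm_inv, mul_pow, inv_pow, Complex.norm_of_nonneg ht.le, ← htb]
      congr 4
      field_simp
      ring
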